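/- (Main Theorem) Let ϖ be a modulus of continuity and φ : [0,∞) → (0,∞) a nondecreasing continuous function. Let T be a C_{2,ϖ} orientation-preserving circle diffeomorphism with irrational rotation number ρ = [k₁,k₂,…] whose partial quotients satisfy k_{n+1} ≤ c·φ(n) for some constant c > 0 and all n ∈ ℕ. Let λ = 1/√(1 + e^{−𝒞}) with 𝒞 = ∫₀¹ |F″(x)/F′(x)| dx. If ∫₀¹ (∫₀^y φ(log_λ x) dx) · ϖ(y)/y² dy < +∞, then T admits a C¹ conjugacy to the rigid rotation R_ρ. -/

import Mathlib

/-- A modulus of continuity. -/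
structure IsModulus (w : ℝ → ℝ) : Prop where
  pos : ∀ x : ℝ, 0 < x → 0 < w x
  strictMono : StrictMonoOn w (Set.Ioi 0)
  continuous : ContinuousOn w (Set.Ioi 0)
  subadd : ∀ x y : ℝ, 0 < x → 0 < y → w (x + y) ≤ w x + w y
  tendsto : Filter.Tendsto w (nhdsWithin 0 (Set.Ioi 0)) (nhds 0)

section

open Filter Topology Finset

namespace IsModulus

variable {w : ℝ → ℝ}

lemma mono (hw : IsModulus w) {x y : ℝ} (hx : 0 < x) (hxy : x ≤ y) : w x ≤ w y :=
  hw.strictMono.monotoneOn hx (lt_of_lt_of_le hx hxy) hxy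

lemma nat_mul_le (hw : IsModulus w) {x : ℝ} (hx : 0 < x) (n : ℕ) :
    w (((n : ℝ) + 1) * x) ≤ ((n : ℝ) + 1) * w x := by
  induction n with
  | zero => simp
  | succ n ih =>
    have h := hw.subadd (((n : ℝ) + 1) * x) x (by positivity) hx
    push_cast
    have e : ((n : ℝ) + 1 + 1) * x = ((n : ℝ) + 1) * x + x := by ring
    rw [e]
    linarith

lemma exists_mul_le (hw : IsModulus w) (C : ℝ) (hC : 0 < C) :
    ∃ K : ℝ, 0 < K ∧ ∀ x, 0 < x → w (C * x) ≤ K * w x := by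
  refine ⟨(⌈C⌉₊ : ℝ) + 1, by positivity, fun x hx => ?_⟩
  refine (hw.mono (by positivity) ?_).trans (hw.nat_mul_le hx _)
  have := Nat.le_ceil C
  gcongr
  linarith

lemma exists_le_mul (hw : IsModulus w) :
    ∃ K : ℝ, 0 < K ∧ ∀ x, 0 < x → x ≤ 1 → x ≤ K * w x := by
  have h1 := hw.pos 1 one_pos
  refine ⟨2 / w 1, by positivity, fun x hx hx1 => ?_⟩
  have hfl : (⌊1 / x⌋₊ : ℝ) ≤ 1 / x := Nat.floor_le (by positivity)
  have hfu : 1 / x < (⌊1 / x⌋₊ : ℝ) + 1 := Nat.lt_floor_add_one _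
  have h2 : 1 ≤ ((⌊1 / x⌋₊ : ℝ) + 1) * x := by
    rw [div_lt_iff₀ hx] at hfu
    exact hfu.le
  have h3 := (hw.mono one_pos h2).trans (hw.nat_mul_le hx _)
  have h4 : 1 ≤ 1 / x := by rw [le_div_iff₀ hx]; linarith
  have h5 : w 1 ≤ (2 / x) * w x := by
    refine h3.trans ?_
    have := hw.pos x hx
    have e : 2 / x = 1 / x + 1 / x := by ring
    rw [e]
    gcongr
  have h6 : x * w 1 ≤ 2 * w x := by
    calc x * w 1 ≤ x * ((2 / x) * w x) := by gcongr
      _ = 2 * w x := by field_simp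
  rw [div_mul_eq_mul_div, le_div_iff₀ h1]
  exact h6

end IsModulus

/-- The lift `F` of a `C_{2,w}` circle diffeomorphism with derivatives `F'`, `F''`. -/
structure IsC2Lift (w F F' F'' : ℝ → ℝ) : Prop where
  modulus : IsModulus w
  strictMono : StrictMono F
  map_add_one : ∀ x, F (x + 1) = F x + 1
  hasDerivAt : ∀ x, HasDerivAt F (F' x) x
  hasDerivAt' : ∀ x, HasDerivAt F' (F'' x) x
  deriv_pos : ∀ x, 0 < F' x
  sub_le : ∀ x y : ℝ, x ≠ y → |F'' x - F'' y| ≤ w |x - y|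

namespace IsC2Lift

variable {w F F' F'' : ℝ → ℝ}

lemma continuous (h : IsC2Lift w F F' F'') : Continuous F :=
  continuous_iff_continuousAt.2 fun x => (h.hasDerivAt x).continuousAt

lemma continuous_deriv (h : IsC2Lift w F F' F'') : Continuous F' :=
  continuous_iff_continuousAt.2 fun x => (h.hasDerivAt' x).continuousAt

lemma continuous_deriv_two (h : IsC2Lift w F F' F'') : Continuous F'' := by
  rw [Metric.continuous_iff]
  intro x ε hε
  have ht := h.modulus.tendsto
  rw [Metric.tendsto_nhdsWithin_nhds] at ht
  obtain ⟨δ, hδ, H⟩ := ht ε hε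
  refine ⟨δ, hδ, fun y hy => ?_⟩
  rcases eq_or_ne y x with rfl | hne
  · simpa using hε
  · rw [Real.dist_eq] at hy ⊢
    have hp : 0 < |y - x| := abs_pos.2 (sub_ne_zero.2 hne)
    have := H (x := |y - x|) hp (by simpa [Real.dist_eq] using hy)
    rw [Real.dist_eq, sub_zero] at this
    exact (h.sub_le y x hne).trans_lt ((le_abs_self _).trans_lt this)

lemma periodic_deriv (h : IsC2Lift w F F' F'') (x : ℝ) : F' (x + 1) = F' x := by
  have h1 : HasDerivAt (fun y => F (y + 1)) (F' (x + 1)) x :=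
    (h.hasDerivAt (x + 1)).comp_add_const x 1
  have h2 : HasDerivAt (fun y => F (y + 1)) (F' x) x := by
    simp only [h.map_add_one]
    exact (h.hasDerivAt x).add_const 1
  exact h1.unique h2

lemma periodic_deriv_two (h : IsC2Lift w F F' F'') (x : ℝ) : F'' (x + 1) = F'' x := by
  have h1 : HasDerivAt (fun y => F' (y + 1)) (F'' (x + 1)) x :=
    (h.hasDerivAt' (x + 1)).comp_add_const x 1
  have h2 : HasDerivAt (fun y => F' (y + 1)) (F'' x) x := by
    simp only [h.periodic_deriv]
    exact h.hasDerivAt' x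
  exact h1.unique h2

end IsC2Lift

/-- A continuous periodic function on the line is bounded. -/
lemma exists_abs_le_of_periodic {g : ℝ → ℝ} (hg : Continuous g)
    (hp : ∀ x, g (x + 1) = g x) : ∃ B : ℝ, 0 < B ∧ ∀ x, |g x| ≤ B := by
  obtain ⟨C, hC⟩ := isCompact_Icc.exists_bound_of_continuousOn (s := Set.Icc (0 : ℝ) 1)
    hg.continuousOn
  have hper : Function.Periodic g 1 := hp
  refine ⟨max C 1, by positivity, fun x => ?_⟩
  obtain ⟨y, hy, hxy⟩ := hper.exists_mem_Ico₀ one_pos x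
  rw [hxy]
  exact (hC y ⟨hy.1, hy.2.le⟩).trans (le_max_left _ _)

namespace IsC2Lift

variable {w F F' F'' : ℝ → ℝ}

lemma exists_bounds (h : IsC2Lift w F F' F'') :
    ∃ a b : ℝ, 0 < a ∧ 0 < b ∧ (∀ x, a ≤ F' x) ∧ (∀ x, F' x ≤ b) ∧ ∀ x, |F'' x| ≤ b := by
  obtain ⟨B₁, hB₁, H₁⟩ := exists_abs_le_of_periodic h.continuous_deriv h.periodic_deriv
  obtain ⟨B₂, hB₂, H₂⟩ := exists_abs_le_of_periodic h.continuous_deriv_two h.periodic_deriv_two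
  obtain ⟨B₃, hB₃, H₃⟩ := exists_abs_le_of_periodic (g := fun x => (F' x)⁻¹)
    (h.continuous_deriv.inv₀ fun x => (h.deriv_pos x).ne') (fun x => by rw [h.periodic_deriv])
  refine ⟨B₃⁻¹, max B₁ B₂, by positivity, by positivity, fun x => ?_, fun x => ?_, fun x => ?_⟩
  · rw [inv_le_comm₀ hB₃ (h.deriv_pos x)]
    exact (le_abs_self _).trans (H₃ x)
  · exact (le_abs_self _).trans ((H₁ x).trans (le_max_left _ _))
  · exact (H₂ x).trans (le_max_right _ _)

lemma exists_lipschitz_log (h : IsC2Lift w F F' F'') :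
    ∃ M : ℝ, 0 < M ∧ ∀ x y, |Real.log (F' x) - Real.log (F' y)| ≤ M * |x - y| := by
  obtain ⟨a, b, ha, hb, H1, H2, H3⟩ := h.exists_bounds
  refine ⟨b / a, by positivity, fun x y => ?_⟩
  have := Convex.norm_image_sub_le_of_norm_hasDerivWithin_le (s := Set.univ)
    (f := fun x => Real.log (F' x)) (f' := fun x => F'' x / F' x) (C := b / a) (x := y) (y := x)
    (fun z _ => ((h.hasDerivAt' z).log (h.deriv_pos z).ne').hasDerivWithinAt)
    (fun z _ => by
      rw [Real.norm_eq_abs, abs_div, abs_of_pos (h.deriv_pos z)]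
      have := H3 z
      have := H1 z
      gcongr)
    convex_univ (Set.mem_univ _) (Set.mem_univ _)
  simpa [Real.norm_eq_abs] using this

/-- The chord slope of `F` agrees with the arithmetic mean of the end slopes to second order. -/
lemma abs_slope_sub_mean_le (h : IsC2Lift w F F' F'') {u v : ℝ} (huv : u < v) :
    |(F v - F u) / (v - u) - (F' u + F' v) / 2| ≤ (v - u) * w (v - u) := by
  have hd : 0 < v - u := sub_pos.2 huv
  have hwp := h.modulus.pos _ hd
  let g : ℝ → ℝ := fun t => F t - F u - (t - u) * (F' u + F' t) / 2
  have hg : ∀ t, HasDerivAt g (((F' t - F' u) - (t - u) * F'' t) / 2) t := by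
    intro t
    have h1 := ((h.hasDerivAt t).sub_const (F u)).sub
      ((((hasDerivAt_id t).sub_const u).mul ((h.hasDerivAt' t).const_add (F' u))).div_const 2)
    exact h1.congr_deriv (by simp only [id]; ring)
  have key := Convex.norm_image_sub_le_of_norm_hasDerivWithin_le (s := Set.Icc u v)
    (f := g) (C := (v - u) * w (v - u)) (x := u) (y := v)
    (fun z _ => (hg z).hasDerivWithinAt)
    (fun t ht => by
      rw [Real.norm_eq_abs]
      rcases eq_or_lt_of_le ht.1 with rfl | hlt
      · simp only [sub_self, zero_mul, zero_div, abs_zero]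
        positivity
      obtain ⟨c, hc, hce⟩ := exists_hasDerivAt_eq_slope F' F'' hlt
        h.continuous_deriv.continuousOn (fun z _ => h.hasDerivAt' z)
      have ht0 : 0 < t - u := sub_pos.2 hlt
      have e : F' t - F' u = (t - u) * F'' c := by rw [hce]; field_simp
      rw [e, ← mul_sub, abs_div, abs_mul, abs_of_pos ht0, abs_two]
      have h1 := h.sub_le c t hc.2.ne
      have h2 : w |c - t| ≤ w (v - u) := by
        apply h.modulus.mono (abs_pos.2 (sub_ne_zero.2 hc.2.ne))
        rw [abs_sub_comm, abs_of_pos (sub_pos.2 hc.2)]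
        linarith [hc.1, ht.2]
      have h3 : (t - u) * |F'' c - F'' t| ≤ (v - u) * w (v - u) := by
        apply mul_le_mul _ (h1.trans h2) (abs_nonneg _) hd.le
        linarith [ht.2]
      have : 0 < (v - u) * w (v - u) := by positivity
      linarith)
    (convex_Icc u v) (Set.left_mem_Icc.2 huv.le) (Set.right_mem_Icc.2 huv.le)
  have e : (F v - F u) / (v - u) - (F' u + F' v) / 2 = (g v - g u) / (v - u) := by
    simp only [g]
    field_simp
    ring
  rw [e, abs_div, abs_of_pos hd, div_le_iff₀ hd]
  rw [Real.norm_eq_abs, Real.norm_eq_abs, abs_of_pos hd] at key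
  exact key

lemma exists_log_slope_bound (h : IsC2Lift w F F' F'') :
    ∃ K : ℝ, 0 < K ∧ ∀ u v, u ≠ v → |v - u| ≤ 1 →
      |Real.log ((F v - F u) / (v - u)) - (Real.log (F' u) + Real.log (F' v)) / 2|
        ≤ K * (|v - u| * w |v - u|) := by
  obtain ⟨a, b, ha, hb, H1, H2, H3⟩ := h.exists_bounds
  obtain ⟨L, hL, HL⟩ := h.modulus.exists_le_mul
  have key : ∀ u v, u < v → v - u ≤ 1 →
      |Real.log ((F v - F u) / (v - u)) - (Real.log (F' u) + Real.log (F' v)) / 2|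
        ≤ ((2 * b + b ^ 2 * L) / a ^ 2) * ((v - u) * w (v - u)) := by
    intro u v huv hle
    have hd : 0 < v - u := sub_pos.2 huv
    have hwp := h.modulus.pos _ hd
    obtain ⟨c, hc, hce⟩ := exists_hasDerivAt_eq_slope F F' huv
        h.continuous.continuousOn (fun z _ => h.hasDerivAt z)
    obtain ⟨d, hd', hde⟩ := exists_hasDerivAt_eq_slope F' F'' huv
        h.continuous_deriv.continuousOn (fun z _ => h.hasDerivAt' z)
    have h1 := h.abs_slope_sub_mean_le huv
    have hR := h.deriv_pos c
    have hA := h.deriv_pos u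
    have hB := h.deriv_pos v
    rw [← hce] at h1 ⊢
    set R := F' c
    set A := F' u
    set B := F' v
    have hBA : |B - A| ≤ b * (v - u) := by
      have e : B - A = F'' d * (v - u) := by rw [hde]; field_simp
      rw [e, abs_mul, abs_of_pos hd]
      exact mul_le_mul_of_nonneg_right (H3 d) hd.le
    have hsq : |R ^ 2 - A * B| ≤ (2 * b + b ^ 2 * L) * ((v - u) * w (v - u)) := by
      have e : R ^ 2 - A * B = (R - (A + B) / 2) * (R + (A + B) / 2) + ((B - A) / 2) ^ 2 := by ring
      rw [e]
      have t1 : |(R - (A + B) / 2) * (R + (A + B) / 2)| ≤ ((v - u) * w (v - u)) * (2 * b) := by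
        rw [abs_mul]
        apply mul_le_mul h1 _ (abs_nonneg _) (by positivity)
        rw [abs_of_pos (by positivity)]
        linarith [H2 c, H2 u, H2 v]
      have t2 : |((B - A) / 2) ^ 2| ≤ b ^ 2 * L * ((v - u) * w (v - u)) := by
        rw [abs_of_nonneg (sq_nonneg _), div_pow, ← sq_abs]
        have t3 : |B - A| ^ 2 ≤ (b * (v - u)) ^ 2 := by gcongr
        have t4 : (b * (v - u)) ^ 2 ≤ b ^ 2 * L * ((v - u) * w (v - u)) := by
          have := HL _ hd hle
          calc (b * (v - u)) ^ 2 = b ^ 2 * (v - u) * (v - u) := by ring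
            _ ≤ b ^ 2 * (v - u) * (L * w (v - u)) := by gcongr
            _ = _ := by ring
        have t5 : 0 ≤ |B - A| ^ 2 := by positivity
        linarith
      refine (abs_add_le _ _).trans ?_
      linarith
    have hlog : |Real.log (R ^ 2) - Real.log (A * B)| ≤ |R ^ 2 - A * B| / a ^ 2 := by
      have := Convex.norm_image_sub_le_of_norm_hasDerivWithin_le (s := Set.Ici (a ^ 2))
        (f := Real.log) (f' := fun x => x⁻¹) (C := (a ^ 2)⁻¹) (x := A * B) (y := R ^ 2)
        (fun z hz => (Real.hasDerivAt_log
          (lt_of_lt_of_le (by positivity) hz : (0 : ℝ) < z).ne').hasDerivWithinAt)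
        (fun z hz => by
          have hz' : 0 < z := lt_of_lt_of_le (by positivity) hz
          rw [Real.norm_eq_abs, abs_of_pos (by positivity)]
          exact inv_anti₀ (by positivity) hz)
        (convex_Ici _) (by
          show a ^ 2 ≤ A * B
          rw [sq]; exact mul_le_mul (H1 u) (H1 v) ha.le hA.le)
        (by
          show a ^ 2 ≤ R ^ 2
          have := H1 c
          gcongr)
      rw [Real.norm_eq_abs, Real.norm_eq_abs] at this
      rw [div_eq_inv_mul]
      exact this
    rw [Real.log_pow, Real.log_mul hA.ne' hB.ne'] at hlog
    have e2 : Real.log R - (Real.log A + Real.log B) / 2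
        = (((2 : ℕ) : ℝ) * Real.log R - (Real.log A + Real.log B)) / 2 := by
      push_cast; ring
    rw [e2, abs_div, abs_two, div_le_iff₀ two_pos]
    refine hlog.trans ?_
    rw [div_mul_eq_mul_div, div_mul_eq_mul_div]
    apply div_le_div_of_nonneg_right _ (by positivity)
    have : 0 < (2 * b + b ^ 2 * L) * ((v - u) * w (v - u)) := by positivity
    linarith
  refine ⟨(2 * b + b ^ 2 * L) / a ^ 2, by positivity, fun u v hne hle => ?_⟩
  rcases lt_or_gt_of_ne hne with hlt | hgt
  · have := key u v hlt ((le_abs_self _).trans hle)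
    rwa [abs_of_pos (sub_pos.2 hlt)]
  · rw [abs_sub_comm v u] at hle ⊢
    have := key v u hgt ((le_abs_self _).trans hle)
    rw [abs_of_pos (sub_pos.2 hgt)]
    rw [← neg_sub (F u) (F v), ← neg_sub u v, neg_div_neg_eq, add_comm (Real.log (F' u))]
    exact this

end IsC2Lift

/-- The logarithm `∑_{i<m} log F'(Fⁱ x)` of the derivative of `F^m` at `x`. -/
noncomputable def logDerivIter (F F' : ℝ → ℝ) (m : ℕ) (x : ℝ) : ℝ :=
  ∑ i ∈ range m, Real.log (F' (F^[i] x))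

lemma logDerivIter_add (F F' : ℝ → ℝ) (m n : ℕ) (x : ℝ) :
    logDerivIter F F' (m + n) x = logDerivIter F F' m x + logDerivIter F F' n (F^[m] x) := by
  simp only [logDerivIter, sum_range_add, ← Function.iterate_add_apply]
  simp only [add_comm]

lemma logDerivIter_one (F F' : ℝ → ℝ) (x : ℝ) :
    logDerivIter F F' 1 x = Real.log (F' x) := by
  simp [logDerivIter]

/-- `|log y| ≤ B |y - 1|`-type bound in exponential form. -/
lemma abs_le_exp_mul_abs_exp_sub_one {s B : ℝ} (hs : |s| ≤ B) :
    |s| ≤ Real.exp B * |Real.exp s - 1| := by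
  have hB : 0 ≤ B := (abs_nonneg s).trans hs
  have h1 := Real.one_le_exp hB
  rcases le_or_gt 0 s with h | h
  · have h2 := Real.add_one_le_exp s
    rw [abs_of_nonneg h, abs_of_nonneg (by linarith)]
    nlinarith
  · have h2 := Real.add_one_le_exp (-s)
    have h3 : Real.exp s < 1 := by simpa using Real.exp_lt_exp.2 h
    rw [abs_of_neg h, abs_of_neg (by linarith)]
    rw [abs_of_neg h] at hs
    have h4 : Real.exp (-s) ≤ Real.exp B := Real.exp_le_exp.2 hs
    have h5 : Real.exp (-s) * Real.exp s = 1 := by rw [← Real.exp_add]; simp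
    have h6 : Real.exp (-s) * (1 - Real.exp s) ≤ Real.exp B * (1 - Real.exp s) :=
      mul_le_mul_of_nonneg_right h4 (by linarith)
    linarith

lemma abs_exp_sub_one_le_exp_mul {s B : ℝ} (hs : |s| ≤ B) :
    |Real.exp s - 1| ≤ Real.exp B * |s| := by
  have hB : 0 ≤ B := (abs_nonneg s).trans hs
  have h1 := Real.one_le_exp hB
  rcases le_or_gt 0 s with h | h
  · have h2 := Real.add_one_le_exp (-s)
    have h3 : 1 ≤ Real.exp s := Real.one_le_exp h
    rw [abs_of_nonneg h, abs_of_nonneg (by linarith)]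
    rw [abs_of_nonneg h] at hs
    have h4 : Real.exp s ≤ Real.exp B := Real.exp_le_exp.2 hs
    have h5 : Real.exp (-s) * Real.exp s = 1 := by rw [← Real.exp_add]; simp
    nlinarith
  · have h2 := Real.add_one_le_exp s
    have h3 : Real.exp s < 1 := by simpa using Real.exp_lt_exp.2 h
    rw [abs_of_neg h, abs_of_neg (by linarith)]
    nlinarith

namespace IsC2Lift

variable {w F F' F'' : ℝ → ℝ}

lemma iterate_sub_nat (h : IsC2Lift w F F' F'') (m n : ℕ) (x : ℝ) :
    F^[m] (x - n) = F^[m] x - n := by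
  have h1 : ∀ n : ℕ, ∀ x, F (x - n) = F x - n := by
    intro n
    induction n with
    | zero => simp
    | succ n ih =>
      intro x
      have := h.map_add_one (x - (n + 1))
      have e : x - (n + 1) + 1 = x - (n : ℝ) := by ring
      rw [e, ih] at this
      push_cast
      linarith
  induction m with
  | zero => simp
  | succ m ih => rw [Function.iterate_succ_apply', ih, h1, Function.iterate_succ_apply']

lemma deriv_sub_nat (h : IsC2Lift w F F' F'') (n : ℕ) (x : ℝ) : F' (x - n) = F' x := by
  have : Function.Periodic F' 1 := h.periodic_deriv
  simpa using this.sub_nat_mul_eq (x := x) n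

lemma logDerivIter_sub_nat (h : IsC2Lift w F F' F'') (m n : ℕ) (x : ℝ) :
    logDerivIter F F' m (x - n) = logDerivIter F F' m x := by
  simp only [logDerivIter, h.iterate_sub_nat, h.deriv_sub_nat]

lemma hasDerivAt_iterate (h : IsC2Lift w F F' F'') (m : ℕ) (x : ℝ) :
    HasDerivAt F^[m] (Real.exp (logDerivIter F F' m x)) x := by
  induction m with
  | zero => simpa [logDerivIter] using hasDerivAt_id x
  | succ m ih =>
    rw [Function.iterate_succ', logDerivIter_add, Real.exp_add, logDerivIter_one,
      Real.exp_log (h.deriv_pos _), mul_comm]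
    exact (h.hasDerivAt _).comp x ih

lemma continuous_iterate (h : IsC2Lift w F F' F'') (m : ℕ) : Continuous F^[m] :=
  h.continuous.iterate m

lemma continuous_logDerivIter (h : IsC2Lift w F F' F'') (m : ℕ) :
    Continuous (logDerivIter F F' m) := by
  unfold logDerivIter
  refine continuous_finsetSum _ fun i _ => ?_
  exact (h.continuous_deriv.comp (h.continuous_iterate i)).log fun x => (h.deriv_pos _).ne'

lemma abs_logDerivIter_sub_le (_h : IsC2Lift w F F' F'') {M : ℝ}
    (hM : ∀ x y, |Real.log (F' x) - Real.log (F' y)| ≤ M * |x - y|) (m : ℕ) (x y : ℝ) :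
    |logDerivIter F F' m x - logDerivIter F F' m y|
      ≤ M * ∑ i ∈ range m, |F^[i] x - F^[i] y| := by
  rw [logDerivIter, logDerivIter, ← sum_sub_distrib, mul_sum]
  exact (abs_sum_le_sum_abs _ _).trans (sum_le_sum fun i _ => hM _ _)

lemma abs_log_slope_iterate_le (h : IsC2Lift w F F' F'') {K : ℝ}
    (hK : ∀ u v, u ≠ v → |v - u| ≤ 1 →
      |Real.log ((F v - F u) / (v - u)) - (Real.log (F' u) + Real.log (F' v)) / 2|
        ≤ K * (|v - u| * w |v - u|)) (m : ℕ) {u v : ℝ} (huv : u ≠ v)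
    (hle : ∀ i < m, |F^[i] v - F^[i] u| ≤ 1) :
    |Real.log ((F^[m] v - F^[m] u) / (v - u))
        - (logDerivIter F F' m u + logDerivIter F F' m v) / 2|
      ≤ K * ∑ i ∈ range m, |F^[i] v - F^[i] u| * w |F^[i] v - F^[i] u| := by
  induction m with
  | zero =>
    have : v - u ≠ 0 := sub_ne_zero.2 huv.symm
    simp [logDerivIter, div_self this]
  | succ m ih =>
    have h1 := ih fun i hi => hle i (by omega)
    have hne : F^[m] u ≠ F^[m] v := fun e => huv ((h.strictMono.iterate m).injective e)
    have h2 := hK _ _ hne (hle m (by omega))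
    have hsl : ∀ m : ℕ, 0 < (F^[m] v - F^[m] u) / (v - u) := by
      intro m
      rcases lt_or_gt_of_ne huv with hlt | hgt
      · exact div_pos (sub_pos.2 (h.strictMono.iterate m hlt)) (sub_pos.2 hlt)
      · exact div_pos_of_neg_of_neg (sub_neg.2 (h.strictMono.iterate m hgt)) (sub_neg.2 hgt)
    have e : (F^[m + 1] v - F^[m + 1] u) / (v - u)
        = ((F (F^[m] v) - F (F^[m] u)) / (F^[m] v - F^[m] u))
          * ((F^[m] v - F^[m] u) / (v - u)) := by
      have h3 : F^[m] v - F^[m] u ≠ 0 := sub_ne_zero.2 hne.symm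
      have h4 : v - u ≠ 0 := sub_ne_zero.2 huv.symm
      rw [Function.iterate_succ_apply', Function.iterate_succ_apply']
      field_simp
    have hpos : (F (F^[m] v) - F (F^[m] u)) / (F^[m] v - F^[m] u) ≠ 0 := by
      intro h0
      have := hsl (m + 1)
      rw [e, h0, zero_mul] at this
      exact lt_irrefl _ this
    rw [e, Real.log_mul hpos (hsl m).ne', logDerivIter_add, logDerivIter_add, logDerivIter_one,
      logDerivIter_one, sum_range_succ, mul_add]
    refine le_trans (le_of_eq ?_) ((abs_add_le _ _).trans (add_le_add h1 h2))
    congr 1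
    ring

/-- Mean value theorem for iterates. -/
lemma exists_sub_eq_exp_mul (h : IsC2Lift w F F' F'') (m : ℕ) {u v : ℝ} (huv : u < v) :
    ∃ c ∈ Set.Ioo u v,
      F^[m] v - F^[m] u = Real.exp (logDerivIter F F' m c) * (v - u) := by
  obtain ⟨c, hc, hce⟩ := exists_hasDerivAt_eq_slope F^[m] _ huv
    (h.continuous_iterate m).continuousOn (fun z _ => h.hasDerivAt_iterate m z)
  refine ⟨c, hc, ?_⟩
  have : v - u ≠ 0 := (sub_pos.2 huv).ne'
  rw [hce]
  field_simp

end IsC2Lift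

/-- Continued fraction data: `p n / q n` are the convergents of `ρ` with partial quotients `k`. -/
structure IsConvergents (k p q : ℕ → ℕ) (ρ : ℝ) : Prop where
  one_le : ∀ n, 1 ≤ k (n + 1)
  p_zero : p 0 = 0
  p_one : p 1 = 1
  q_zero : q 0 = 1
  q_one : q 1 = k 1
  p_rec : ∀ n, p (n + 2) = k (n + 2) * p (n + 1) + p n
  q_rec : ∀ n, q (n + 2) = k (n + 2) * q (n + 1) + q n
  tendsto : Tendsto (fun n => (p n : ℝ) / (q n : ℝ)) atTop (𝓝 ρ)

namespace IsConvergents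

variable {k p q : ℕ → ℕ} {ρ : ℝ}

lemma q_pos_and_le (h : IsConvergents k p q ρ) (n : ℕ) : 0 < q n ∧ q n ≤ q (n + 1) := by
  induction n with
  | zero =>
    have := h.one_le 0
    simp only [zero_add] at this ⊢
    rw [h.q_zero, h.q_one]
    omega
  | succ n ih =>
    refine ⟨by omega, ?_⟩
    rw [show n + 1 + 1 = n + 2 from rfl, h.q_rec]
    have := h.one_le (n + 1)
    nlinarith

lemma q_pos (h : IsConvergents k p q ρ) (n : ℕ) : 0 < q n := (h.q_pos_and_le n).1

lemma q_le_succ (h : IsConvergents k p q ρ) (n : ℕ) : q n ≤ q (n + 1) := (h.q_pos_and_le n).2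

lemma add_le_q (h : IsConvergents k p q ρ) (n : ℕ) : q (n + 1) + q n ≤ q (n + 2) := by
  rw [h.q_rec]
  have := h.one_le (n + 1)
  nlinarith

lemma det (h : IsConvergents k p q ρ) (n : ℕ) :
    (p (n + 1) : ℝ) * q n - p n * q (n + 1) = (-1) ^ n := by
  induction n with
  | zero => simp [h.p_zero, h.p_one, h.q_zero]
  | succ n ih =>
    rw [show n + 1 + 1 = n + 2 from rfl, h.q_rec, h.p_rec, pow_succ, ← ih]
    push_cast
    ring

lemma sign_mul_pos (h : IsConvergents k p q ρ) (n : ℕ) :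
    0 < (-1 : ℝ) ^ n * (q n * ρ - p n) := by
  have hq : ∀ m, (0 : ℝ) < q m := fun m => by exact_mod_cast h.q_pos m
  have hstep : ∀ m, (-1 : ℝ) ^ m * (p m / q m) < (-1 : ℝ) ^ m * (p (m + 2) / q (m + 2)) := by
    intro m
    have hk : (0 : ℝ) < k (m + 2) := by exact_mod_cast h.one_le (m + 1)
    have e : (-1 : ℝ) ^ m * (p (m + 2) / q (m + 2)) - (-1 : ℝ) ^ m * (p m / q m)
        = k (m + 2) / (q m * q (m + 2)) := by
      have h1 := h.det m
      have e1 : (p (m + 2) : ℝ) / q (m + 2) - p m / q m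
          = k (m + 2) * (-1) ^ m / (q m * q (m + 2)) := by
        rw [div_sub_div _ _ (hq _).ne' (hq _).ne', ← h1]
        have hpr : (p (m + 2) : ℝ) = k (m + 2) * p (m + 1) + p m := by exact_mod_cast h.p_rec m
        have hqr : (q (m + 2) : ℝ) = k (m + 2) * q (m + 1) + q m := by exact_mod_cast h.q_rec m
        congr 1
        · rw [hpr, hqr]
          ring
        · ring
      rw [← mul_sub, e1, mul_div_assoc', mul_left_comm, ← pow_add, ← two_mul, pow_mul]
      simp
    have : (0 : ℝ) < k (m + 2) / (q m * q (m + 2)) := div_pos hk (mul_pos (hq _) (hq _))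
    linarith
  let c : ℕ → ℝ := fun j => (-1 : ℝ) ^ n * (p (n + 2 * j) / q (n + 2 * j))
  have hc : StrictMono c := strictMono_nat_of_lt_succ fun j => by
    have := hstep (n + 2 * j)
    rw [pow_add, pow_mul] at this
    simpa [c, mul_add, add_assoc] using this
  have hlim : Tendsto c atTop (𝓝 ((-1 : ℝ) ^ n * ρ)) := by
    have ht : Tendsto (fun j : ℕ => n + 2 * j) atTop atTop :=
      tendsto_atTop_mono (fun j => by simp only [id]; omega) tendsto_id
    exact (h.tendsto.comp ht).const_mul _
  have h0 : c 0 < (-1 : ℝ) ^ n * ρ :=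
    (hc one_pos).trans_le (hc.monotone.ge_of_tendsto hlim 1)
  have h1 : (-1 : ℝ) ^ n * (p n / q n) < (-1 : ℝ) ^ n * ρ := h0
  have h2 := mul_pos (hq n) (sub_pos.2 h1)
  have e : (q n : ℝ) * ((-1 : ℝ) ^ n * ρ - (-1 : ℝ) ^ n * (p n / q n))
      = (-1 : ℝ) ^ n * (q n * ρ - p n) := by
    have := (hq n).ne'
    field_simp
  rwa [e] at h2

lemma sign_mul_add_pos (h : IsConvergents k p q ρ) (n : ℕ) :
    0 < (-1 : ℝ) ^ n * ((q n + q (n + 1) : ℕ) * ρ - (p n + p (n + 1) : ℕ)) := by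
  have h1 := h.sign_mul_pos (n + 1)
  have h2 := h.sign_mul_pos (n + 2)
  have hk : (1 : ℝ) ≤ k (n + 2) := by exact_mod_cast h.one_le (n + 1)
  rw [h.q_rec, h.p_rec, pow_add] at h2
  rw [pow_succ] at h1
  push_cast at h2 ⊢
  nlinarith

end IsConvergents

/-- The return map `F^{q n} - p n` near a point. -/
noncomputable def ret (F : ℝ → ℝ) (p q : ℕ → ℕ) (n : ℕ) (x : ℝ) : ℝ := F^[q n] x - p n

/-- The length of the arc between `x` and its `n`-th closest return. -/
noncomputable def gap (F : ℝ → ℝ) (p q : ℕ → ℕ) (n : ℕ) (x : ℝ) : ℝ :=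
  (-1) ^ n * (ret F p q n x - x)

/-- A `C_{2,w}` lift whose rotation number `ρ` has convergents `p n / q n`. -/
structure IsRotationLift (w F F' F'' : ℝ → ℝ) (k p q : ℕ → ℕ) (ρ : ℝ) : Prop extends
    IsC2Lift w F F' F'', IsConvergents k p q ρ where
  rotation : ∀ x : ℝ, Tendsto (fun n : ℕ => (F^[n] x - x) / (n : ℝ)) atTop (𝓝 ρ)

namespace IsRotationLift

variable {w F F' F'' : ℝ → ℝ} {k p q : ℕ → ℕ} {ρ : ℝ}

lemma iterate_sub_sign (h : IsRotationLift w F F' F'' k p q ρ) {s : ℝ} (hs : s = 1 ∨ s = -1)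
    {j m : ℕ} (hjm : 0 < s * (j * ρ - m)) (x : ℝ) : 0 < s * (F^[j] x - m - x) := by
  let f : CircleDeg1Lift := ⟨⟨F, h.strictMono.monotone⟩, h.map_add_one⟩
  have hf : ∀ n : ℕ, ⇑(f ^ n) = F^[n] := fun n => CircleDeg1Lift.coe_pow f n
  have hτ : f.translationNumber = ρ := by
    refine tendsto_nhds_unique (f.tendsto_translationNumber 0) ?_
    simp only [hf]
    exact h.rotation 0
  have hτj : (f ^ j).translationNumber = j * ρ := by
    rw [CircleDeg1Lift.translationNumber_pow, hτ]
  rcases hs with rfl | rfl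
  · have h1 : (m : ℝ) < (f ^ j).translationNumber := by rw [hτj]; linarith
    have := CircleDeg1Lift.lt_map_of_nat_lt_translationNumber (f ^ j) h1 x
    rw [hf] at this
    linarith
  · have h1 : (f ^ j).translationNumber < m := by rw [hτj]; linarith
    have := CircleDeg1Lift.map_lt_of_translationNumber_lt_nat (f ^ j) h1 x
    rw [hf] at this
    linarith

lemma gap_pos (h : IsRotationLift w F F' F'' k p q ρ) (n : ℕ) (x : ℝ) : 0 < gap F p q n x :=
  h.iterate_sub_sign (neg_one_pow_eq_or ℝ n) (h.sign_mul_pos n) x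

lemma gap_add_two_lt (h : IsRotationLift w F F' F'' k p q ρ) (n : ℕ) (x : ℝ) :
    gap F p q (n + 2) x < gap F p q n x := by
  have h1 : 0 < (-1 : ℝ) ^ (n + 1) *
      ((k (n + 2) * q (n + 1) : ℕ) * ρ - (k (n + 2) * p (n + 1) : ℕ)) := by
    have hk : (0 : ℝ) < k (n + 2) := by exact_mod_cast h.one_le (n + 1)
    have := mul_pos hk (h.sign_mul_pos (n + 1))
    push_cast
    linarith
  have h2 := h.iterate_sub_sign (neg_one_pow_eq_or ℝ (n + 1)) h1 (F^[q n] x)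
  rw [← Function.iterate_add_apply, ← h.q_rec] at h2
  have hp : (p (n + 2) : ℝ) = (k (n + 2) * p (n + 1) : ℕ) + p n := by
    rw [h.p_rec]; push_cast; ring
  simp only [gap, ret, hp, pow_succ] at h2 ⊢
  linarith

lemma ret_ret_sign (h : IsRotationLift w F F' F'' k p q ρ) (n : ℕ) (x : ℝ) :
    0 < (-1 : ℝ) ^ n * (ret F p q n (ret F p q (n + 1) x) - x) := by
  have := h.iterate_sub_sign (neg_one_pow_eq_or ℝ n) (h.sign_mul_add_pos n) x
  rw [Function.iterate_add_apply] at this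
  simp only [ret, h.iterate_sub_nat]
  push_cast at this
  linarith

lemma ret_comm (h : IsRotationLift w F F' F'' k p q ρ) (m n : ℕ) (x : ℝ) :
    ret F p q m (ret F p q n x) = ret F p q n (ret F p q m x) := by
  simp only [ret, h.iterate_sub_nat, ← Function.iterate_add_apply]
  rw [add_comm (q m)]
  ring

lemma iterate_ret (h : IsRotationLift w F F' F'' k p q ρ) (i n : ℕ) (x : ℝ) :
    F^[i] (ret F p q n x) = ret F p q n (F^[i] x) := by
  simp only [ret, h.iterate_sub_nat, ← Function.iterate_add_apply]
  rw [add_comm]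

lemma gap_eq_abs (h : IsRotationLift w F F' F'' k p q ρ) (n : ℕ) (x : ℝ) :
    gap F p q n x = |ret F p q n x - x| := by
  rw [← abs_of_pos (h.gap_pos n x), gap, abs_mul]
  simp

/-- The arcs of two consecutive generations fill the circle. -/
lemma sum_gap (h : IsRotationLift w F F' F'' k p q ρ) (n : ℕ) (x : ℝ) :
    ∑ i ∈ range (q (n + 1)), gap F p q n (F^[i] x)
      + ∑ i ∈ range (q n), gap F p q (n + 1) (F^[i] x) = 1 := by
  simp only [gap, ret, ← mul_sum, sum_sub_distrib, sum_const, card_range, nsmul_eq_mul,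
    ← Function.iterate_add_apply]
  have e1 := sum_range_add (fun i => F^[i] x) (q n) (q (n + 1))
  have e2 := sum_range_add (fun i => F^[i] x) (q (n + 1)) (q n)
  rw [add_comm (q (n + 1)), e1] at e2
  have hd := h.det n
  rw [pow_succ]
  have h1 : ((-1 : ℝ) ^ n) * (-1) ^ n = 1 := by rw [← pow_add, ← two_mul, pow_mul]; simp
  linear_combination (-1 : ℝ) ^ n * e2 + (-1 : ℝ) ^ n * hd + h1

lemma sum_gap_le (h : IsRotationLift w F F' F'' k p q ρ) (n : ℕ) (x : ℝ) :
    ∑ i ∈ range (q (n + 1)), gap F p q n (F^[i] x) ≤ 1 := by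
  rw [← h.sum_gap n x]
  have : 0 ≤ ∑ i ∈ range (q n), gap F p q (n + 1) (F^[i] x) :=
    sum_nonneg fun i _ => (h.gap_pos _ _).le
  linarith

lemma sum_gap_le_of_le (h : IsRotationLift w F F' F'' k p q ρ) {n m : ℕ} (hm : m ≤ q (n + 1))
    (x : ℝ) : ∑ i ∈ range m, gap F p q n (F^[i] x) ≤ 1 :=
  (sum_le_sum_of_subset_of_nonneg (range_mono hm) fun _ _ _ => (h.gap_pos _ _).le).trans
    (h.sum_gap_le n x)

lemma gap_le_one (h : IsRotationLift w F F' F'' k p q ρ) (n : ℕ) (x : ℝ) :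
    gap F p q n x ≤ 1 := by
  have := h.sum_gap_le_of_le (m := 1) (n := n) (h.q_pos (n + 1)) x
  simpa using this

lemma abs_iterate_sub_le (h : IsRotationLift w F F' F'' k p q ρ) (n i : ℕ) {x u v : ℝ}
    (hu : u ∈ Set.uIcc x (ret F p q n x)) (hv : v ∈ Set.uIcc x (ret F p q n x)) :
    |F^[i] u - F^[i] v| ≤ gap F p q n (F^[i] x) := by
  have hm := (h.strictMono.iterate i).monotone
  rw [h.gap_eq_abs, ← h.iterate_ret, abs_sub_comm (F^[i] (ret F p q n x))]
  have hu' := hm.mapsTo_uIcc hu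
  have hv' := hm.mapsTo_uIcc hv
  rw [Set.mem_uIcc] at hu' hv'
  rcases hu' with a | a <;> rcases hv' with b | b <;> rcases abs_cases (F^[i] u - F^[i] v) with c | c
    <;> rcases abs_cases (F^[i] x - F^[i] (ret F p q n x)) with d | d <;> linarith [a.1, a.2, b.1, b.2]

lemma abs_iterate_sub_le_exp (h : IsRotationLift w F F' F'' k p q ρ) {m : ℕ} {b : ℝ}
    (hb : ∀ x, logDerivIter F F' m x ≤ b) {s : ℝ} (hs : s = 1 ∨ s = -1) {u v : ℝ}
    (huv : 0 < s * (v - u)) : s * (F^[m] v - F^[m] u) ≤ Real.exp b * (s * (v - u)) := by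
  rcases hs with rfl | rfl
  · obtain ⟨c, -, hc⟩ := h.exists_sub_eq_exp_mul m (u := u) (v := v) (by linarith)
    rw [one_mul, one_mul, hc]
    have : Real.exp (logDerivIter F F' m c) ≤ Real.exp b := Real.exp_le_exp.2 (hb c)
    apply mul_le_mul_of_nonneg_right this
    linarith
  · obtain ⟨c, -, hc⟩ := h.exists_sub_eq_exp_mul m (u := v) (v := u) (by linarith)
    have : Real.exp (logDerivIter F F' m c) ≤ Real.exp b := Real.exp_le_exp.2 (hb c)
    have := mul_le_mul_of_nonneg_right this (show 0 ≤ u - v by linarith)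
    linarith

lemma gap_succ_le (h : IsRotationLift w F F' F'' k p q ρ) {n : ℕ} {b : ℝ}
    (hb : ∀ x, logDerivIter F F' (q (n + 1)) x ≤ b) (x : ℝ) :
    gap F p q (n + 1) x ≤ Real.exp b * gap F p q n x := by
  have h1 := h.ret_ret_sign n x
  have h2 := h.abs_iterate_sub_le_exp hb (neg_one_pow_eq_or ℝ n) (h.gap_pos n x)
  have h3 : ret F p q n (ret F p q (n + 1) x) - ret F p q (n + 1) x
      = F^[q (n + 1)] (ret F p q n x) - F^[q (n + 1)] x := by
    rw [h.ret_comm]; simp only [ret]; ring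
  rw [← h3] at h2
  have h4 : gap F p q n x = (-1) ^ n * (ret F p q n x - x) := rfl
  rw [h4]
  refine le_trans ?_ h2
  rw [gap, pow_succ]
  linarith

lemma gap_add_two_mul_le (h : IsRotationLift w F F' F'' k p q ρ) {n : ℕ} {b : ℝ}
    (hb : ∀ x, logDerivIter F F' (q (n + 1)) x ≤ b) (x : ℝ) :
    gap F p q (n + 2) x * (1 + Real.exp (-b)) ≤ gap F p q n x := by
  obtain ⟨j, hj⟩ : ∃ j, k (n + 2) = j + 1 := ⟨k (n + 2) - 1, by
    have : 1 ≤ k (n + 2) := h.one_le (n + 1)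
    omega⟩
  set z : ℝ := F^[j * q (n + 1) + q n] x - (j * p (n + 1) + p n : ℕ) with hz
  have hy : ret F p q (n + 2) x = ret F p q (n + 1) z := by
    rw [hz, ret, ret, h.iterate_sub_nat, ← Function.iterate_add_apply, h.q_rec, h.p_rec, hj]
    have : (j + 1) * q (n + 1) + q n = q (n + 1) + (j * q (n + 1) + q n) := by ring
    rw [this]
    push_cast
    ring
  have hgz : 0 < (-1 : ℝ) ^ n * (z - ret F p q (n + 1) z) := by
    have := h.gap_pos (n + 1) z
    rw [gap, pow_succ] at this
    linarith
  have hzle : (-1 : ℝ) ^ n * (z - x) ≤ gap F p q n x := by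
    have hzr : 0 ≤ (-1 : ℝ) ^ (n + 1) * (z - ret F p q n x) := by
      rcases Nat.eq_zero_or_pos j with rfl | hj0
      · simp [hz, ret]
      have h1 : 0 < (-1 : ℝ) ^ (n + 1) * ((j * q (n + 1) : ℕ) * ρ - (j * p (n + 1) : ℕ)) := by
        have hk : (0 : ℝ) < j := by exact_mod_cast hj0
        have := mul_pos hk (h.sign_mul_pos (n + 1))
        push_cast
        linarith
      have h2 := h.iterate_sub_sign (neg_one_pow_eq_or ℝ (n + 1)) h1 (F^[q n] x)
      rw [← Function.iterate_add_apply] at h2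
      rw [hz, ret]
      push_cast at h2 ⊢
      linarith
    rw [pow_succ] at hzr
    rw [gap]
    linarith
  have h1 := h.ret_ret_sign (n + 1) x
  have h2 := h.abs_iterate_sub_le_exp hb (neg_one_pow_eq_or ℝ n) hgz
  have h3 : F^[q (n + 1)] z - F^[q (n + 1)] (ret F p q (n + 1) z)
      = ret F p q (n + 2) x - ret F p q (n + 1) (ret F p q (n + 2) x) := by
    rw [hy]; simp only [ret]; ring
  rw [h3] at h2
  have h4 : gap F p q (n + 2) x ≤ Real.exp b * ((-1 : ℝ) ^ n * (z - ret F p q (n + 1) z)) := by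
    refine le_trans ?_ h2
    rw [gap, pow_add]
    rw [pow_succ] at h1
    linarith
  have h5 : gap F p q (n + 2) x * Real.exp (-b) ≤ (-1 : ℝ) ^ n * (z - ret F p q (n + 1) z) := by
    have he : Real.exp b * Real.exp (-b) = 1 := by rw [← Real.exp_add]; simp
    have := mul_le_mul_of_nonneg_right h4 (Real.exp_pos (-b)).le
    calc _ ≤ _ := this
      _ = (Real.exp b * Real.exp (-b)) * ((-1 : ℝ) ^ n * (z - ret F p q (n + 1) z)) := by ring
      _ = _ := by rw [he, one_mul]
  rw [← hy] at h5
  have h6 : gap F p q (n + 2) x = (-1 : ℝ) ^ n * (ret F p q (n + 2) x - x) := by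
    rw [gap, pow_add]; simp
  rw [mul_add, mul_one]
  nlinarith

end IsRotationLift

namespace IsRotationLift

variable {w F F' F'' : ℝ → ℝ} {k p q : ℕ → ℕ} {ρ : ℝ}

lemma logDerivIter_ret (h : IsRotationLift w F F' F'' k p q ρ) (m n : ℕ) (x : ℝ) :
    logDerivIter F F' m (ret F p q n x) = logDerivIter F F' m (F^[q n] x) :=
  h.logDerivIter_sub_nat m (p n) _

lemma logDerivIter_ret_sub_comm (_h : IsRotationLift w F F' F'' k p q ρ) (m n : ℕ) (x : ℝ) :
    logDerivIter F F' m (F^[n] x) - logDerivIter F F' m x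
      = logDerivIter F F' n (F^[m] x) - logDerivIter F F' n x := by
  have h1 := logDerivIter_add F F' m n x
  have h2 := logDerivIter_add F F' n m x
  rw [add_comm n m] at h2
  linarith

lemma gap_ret (h : IsRotationLift w F F' F'' k p q ρ) (m l : ℕ) (z : ℝ) :
    ∃ c ∈ Set.uIcc z (ret F p q m z),
      gap F p q m (ret F p q l z) = Real.exp (logDerivIter F F' (q l) c) * gap F p q m z := by
  have hr : ret F p q m (ret F p q l z) - ret F p q l z
      = F^[q l] (ret F p q m z) - F^[q l] z := by
    rw [h.ret_comm]; simp only [ret]; ring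
  rw [gap, hr, gap]
  have hp := h.gap_pos m z
  rcases lt_trichotomy z (ret F p q m z) with hlt | heq | hgt
  · obtain ⟨c, hc, hce⟩ := h.exists_sub_eq_exp_mul (q l) hlt
    exact ⟨c, Set.Icc_subset_uIcc ⟨hc.1.le, hc.2.le⟩, by rw [hce]; ring⟩
  · rw [gap, ← heq] at hp
    simp at hp
  · obtain ⟨c, hc, hce⟩ := h.exists_sub_eq_exp_mul (q l) hgt
    refine ⟨c, Set.Icc_subset_uIcc' ⟨hc.1.le, hc.2.le⟩, ?_⟩
    rw [← neg_sub (F^[q l] z), hce]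
    ring

lemma abs_logDerivIter_sub_le_of_mem (h : IsRotationLift w F F' F'' k p q ρ) {M : ℝ} (hM0 : 0 < M)
    (hM : ∀ x y, |Real.log (F' x) - Real.log (F' y)| ≤ M * |x - y|) {n j : ℕ}
    (hj : j ≤ q (n + 1)) {z c d : ℝ} (hc : c ∈ Set.uIcc z (ret F p q n z))
    (hd : d ∈ Set.uIcc z (ret F p q n z)) :
    |logDerivIter F F' j c - logDerivIter F F' j d| ≤ M := by
  refine (h.abs_logDerivIter_sub_le hM j c d).trans ?_
  have h1 : ∑ i ∈ range j, |F^[i] c - F^[i] d| ≤ 1 :=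
    (sum_le_sum fun i _ => h.abs_iterate_sub_le n i hc hd).trans (h.sum_gap_le_of_le hj z)
  nlinarith

lemma sign_mul_logDerivIter_le (h : IsRotationLift w F F' F'' k p q ρ) {M : ℝ} (hM0 : 0 < M)
    (hM : ∀ x y, |Real.log (F' x) - Real.log (F' y)| ≤ M * |x - y|) {s : ℝ}
    (hs : s = 1 ∨ s = -1) (n : ℕ) (y : ℝ) :
    s * logDerivIter F F' (q (n + 1)) y ≤ 2 * M := by
  by_contra! hcon
  have habs : ∀ a : ℝ, |a| ≤ M → -M ≤ s * a := by
    intro a ha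
    have := abs_le.1 ha
    rcases hs with rfl | rfl <;> linarith
  have hexp : ∀ a : ℝ, 0 < s * a → 0 < s * (Real.exp a - 1) := by
    intro a ha
    rcases hs with rfl | rfl
    · have := Real.one_lt_exp_iff.2 (show 0 < a by linarith)
      linarith
    · have := Real.exp_lt_exp.2 (show a < 0 by linarith)
      rw [Real.exp_zero] at this
      linarith
  have horb : ∀ i ≤ q (n + 2), M < s * logDerivIter F F' (q (n + 1)) (F^[i] y) := by
    intro i hi
    have h1 := h.logDerivIter_ret_sub_comm (q (n + 1)) i y
    rw [← h.logDerivIter_ret] at h1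
    have h2 := habs _ (h.abs_logDerivIter_sub_le_of_mem hM0 hM hi
      (Set.right_mem_uIcc (a := y) (b := ret F p q (n + 1) y)) Set.left_mem_uIcc)
    rw [← h1, mul_sub] at h2
    linarith
  have hgrow : ∀ m, q (n + 1) ≤ q (m + 1) → ∀ i ≤ q (n + 2),
      0 < s * (gap F p q m (F^[i] (ret F p q (n + 1) y)) - gap F p q m (F^[i] y)) := by
    intro m hm i hi
    rw [h.iterate_ret]
    obtain ⟨c, hc, hce⟩ := h.gap_ret m (n + 1) (F^[i] y)
    have h1 := habs _ (h.abs_logDerivIter_sub_le_of_mem hM0 hM hm hc Set.left_mem_uIcc)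
    have h2 := hexp (logDerivIter F F' (q (n + 1)) c) (by linarith [horb i hi])
    rw [hce]
    have := mul_pos h2 (h.gap_pos m (F^[i] y))
    linarith
  have hq0 := h.q_pos n
  have hq1 := h.q_le_succ n
  have hq2 : q (n + 1) ≤ q (n + 2) := h.q_le_succ (n + 1)
  have e1 := h.sum_gap n y
  have e2 := h.sum_gap n (ret F p q (n + 1) y)
  have s1 : 0 < ∑ i ∈ range (q (n + 1)),
      s * (gap F p q n (F^[i] (ret F p q (n + 1) y)) - gap F p q n (F^[i] y)) :=
    sum_pos (fun i hi => hgrow n le_rfl i (by have := mem_range.1 hi; omega))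
      (nonempty_range_iff.2 (by omega))
  have s2 : 0 < ∑ i ∈ range (q n),
      s * (gap F p q (n + 1) (F^[i] (ret F p q (n + 1) y)) - gap F p q (n + 1) (F^[i] y)) :=
    sum_pos (fun i hi => hgrow (n + 1) hq2 i (by have := mem_range.1 hi; omega))
      (nonempty_range_iff.2 (by omega))
  rw [← mul_sum, sum_sub_distrib] at s1 s2
  have : s * (1 - 1) > 0 := by
    calc s * (1 - 1) = s * ((∑ i ∈ range (q (n + 1)), gap F p q n (F^[i] (ret F p q (n + 1) y))
      + ∑ i ∈ range (q n), gap F p q (n + 1) (F^[i] (ret F p q (n + 1) y)))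
      - (∑ i ∈ range (q (n + 1)), gap F p q n (F^[i] y)
      + ∑ i ∈ range (q n), gap F p q (n + 1) (F^[i] y))) := by rw [e1, e2]
      _ > 0 := by linarith
  simp at this

/-- Denjoy's inequality. -/
lemma exists_denjoy_bound (h : IsRotationLift w F F' F'' k p q ρ) :
    ∃ B : ℝ, 0 < B ∧ ∀ n x, |logDerivIter F F' (q n) x| ≤ B := by
  obtain ⟨M, hM0, hM⟩ := h.exists_lipschitz_log
  obtain ⟨B, hB0, hB⟩ := exists_abs_le_of_periodic (h.continuous_logDerivIter 1) (fun x => by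
    have := h.logDerivIter_sub_nat 1 1 (x + 1)
    simpa using this.symm)
  refine ⟨max (2 * M) B, by positivity, fun n x => ?_⟩
  cases n with
  | zero => rw [h.q_zero]; exact (hB x).trans (le_max_right _ _)
  | succ n =>
    refine le_trans (abs_le.2 ⟨?_, ?_⟩) (le_max_left _ _)
    · have := h.sign_mul_logDerivIter_le hM0 hM (Or.inr rfl) n x
      linarith
    · have := h.sign_mul_logDerivIter_le hM0 hM (Or.inl rfl) n x
      linarith

end IsRotationLift

/-- The multiplicative distortion of the return map of generation `n + 1` between the
end points of an arc of generation `n`. -/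
noncomputable def distortion (F F' : ℝ → ℝ) (p q : ℕ → ℕ) (n : ℕ) (x : ℝ) : ℝ :=
  Real.exp (-(logDerivIter F F' (q (n + 1)) (ret F p q n x) - logDerivIter F F' (q (n + 1)) x) / 2)

namespace IsRotationLift

variable {w F F' F'' : ℝ → ℝ} {k p q : ℕ → ℕ} {ρ : ℝ}

lemma abs_log_slope_le_of_mem (h : IsRotationLift w F F' F'' k p q ρ) {K : ℝ} (hK0 : 0 < K)
    (hK : ∀ u v, u ≠ v → |v - u| ≤ 1 →
      |Real.log ((F v - F u) / (v - u)) - (Real.log (F' u) + Real.log (F' v)) / 2|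
        ≤ K * (|v - u| * w |v - u|)) {n m : ℕ} (hm : m ≤ q (n + 1)) {ω : ℝ}
    (hω : ∀ y, w (gap F p q n y) ≤ ω) {x u v : ℝ} (huv : u ≠ v)
    (hu : u ∈ Set.uIcc x (ret F p q n x)) (hv : v ∈ Set.uIcc x (ret F p q n x)) :
    |Real.log ((F^[m] v - F^[m] u) / (v - u))
        - (logDerivIter F F' m u + logDerivIter F F' m v) / 2| ≤ K * ω := by
  have hl : ∀ i, |F^[i] v - F^[i] u| ≤ gap F p q n (F^[i] x) :=
    fun i => h.abs_iterate_sub_le n i hv hu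
  have hω0 : 0 < ω := (h.modulus.pos _ (h.gap_pos n x)).trans_le (hω x)
  refine (h.abs_log_slope_iterate_le hK m huv fun i _ =>
    (hl i).trans (h.gap_le_one n _)).trans ?_
  apply mul_le_mul_of_nonneg_left _ hK0.le
  calc ∑ i ∈ range m, |F^[i] v - F^[i] u| * w |F^[i] v - F^[i] u|
      ≤ ∑ i ∈ range m, gap F p q n (F^[i] x) * ω := by
        refine sum_le_sum fun i _ => ?_
        have hne : F^[i] v - F^[i] u ≠ 0 :=
          sub_ne_zero.2 fun e => huv ((h.strictMono.iterate i).injective e).symm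
        have hp := abs_pos.2 hne
        exact mul_le_mul (hl i) ((h.modulus.mono hp (hl i)).trans (hω _))
          (h.modulus.pos _ hp).le (h.gap_pos n _).le
    _ = (∑ i ∈ range m, gap F p q n (F^[i] x)) * ω := by rw [sum_mul]
    _ ≤ 1 * ω := by
        have := h.sum_gap_le_of_le hm x
        gcongr
    _ = ω := one_mul _

lemma slope_iterate_pos (h : IsRotationLift w F F' F'' k p q ρ) (m : ℕ) {u v : ℝ} (huv : u ≠ v) :
    0 < (F^[m] v - F^[m] u) / (v - u) := by
  have hm := h.strictMono.iterate m
  rcases lt_or_gt_of_ne huv with a | a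
  · exact div_pos (sub_pos.2 (hm a)) (sub_pos.2 a)
  · exact div_pos_of_neg_of_neg (sub_neg.2 (hm a)) (sub_neg.2 a)

lemma distortion_eq (h : IsRotationLift w F F' F'' k p q ρ) (n : ℕ) (x : ℝ) :
    distortion F F' p q n x = Real.exp
      (-(logDerivIter F F' (q n) (ret F p q (n + 1) x) - logDerivIter F F' (q n) x) / 2) := by
  rw [distortion, h.logDerivIter_ret, h.logDerivIter_ret, h.logDerivIter_ret_sub_comm]

lemma distortion_le (_h : IsRotationLift w F F' F'' k p q ρ) {B : ℝ}
    (hB : ∀ n x, |logDerivIter F F' (q n) x| ≤ B) (n : ℕ) (x : ℝ) :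
    distortion F F' p q n x ≤ Real.exp B ∧ Real.exp (-B) ≤ distortion F F' p q n x := by
  have h1 := abs_le.1 (hB (n + 1) x)
  have h2 := abs_le.1 (hB (n + 1) (ret F p q n x))
  constructor <;> apply Real.exp_le_exp.2 <;> linarith

lemma ret_add_two_mem (h : IsRotationLift w F F' F'' k p q ρ) (n : ℕ) (x : ℝ) :
    ret F p q (n + 2) x ∈ Set.uIcc x (ret F p q n x) := by
  have h1 := h.gap_pos (n + 2) x
  have h2 := h.gap_add_two_lt n x
  rw [gap, pow_add] at h1 h2
  rw [gap] at h2
  rw [Set.mem_uIcc]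
  rcases neg_one_pow_eq_or ℝ n with e | e
  · rw [e] at h1 h2; left; constructor <;> linarith
  · rw [e] at h1 h2; right; constructor <;> linarith

lemma abs_distortion_succ_sub_one_le (h : IsRotationLift w F F' F'' k p q ρ) {K B W₀ : ℝ}
    (hK0 : 0 < K) (hK : ∀ u v, u ≠ v → |v - u| ≤ 1 →
      |Real.log ((F v - F u) / (v - u)) - (Real.log (F' u) + Real.log (F' v)) / 2|
        ≤ K * (|v - u| * w |v - u|))
    (hB : ∀ n x, |logDerivIter F F' (q n) x| ≤ B) {n : ℕ} {ω : ℝ}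
    (hω : ∀ y, w (gap F p q n y) ≤ ω) (hω0 : ω ≤ W₀) (x : ℝ) :
    |distortion F F' p q (n + 1) x - 1|
      ≤ gap F p q (n + 2) x / gap F p q n x * |distortion F F' p q n x - 1|
        + (Real.exp B + 1) * (Real.exp (2 * (K * W₀)) * (2 * K)) * ω := by
  set u := x
  set v := ret F p q n x with hv
  set z := ret F p q (n + 2) x with hz
  set m := q (n + 1) with hm
  have hgn := h.gap_pos n x
  have hgn2 := h.gap_pos (n + 2) x
  have hlt := h.gap_add_two_lt n x
  have hs : ((-1 : ℝ) ^ n) ^ 2 = 1 := by rw [← pow_mul, mul_comm, pow_mul]; simp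
  have hvu : v - u = (-1) ^ n * gap F p q n x := by
    rw [gap, ← mul_assoc, ← sq, hs, one_mul]
  have hzu : z - u = (-1) ^ n * gap F p q (n + 2) x := by
    rw [gap, pow_add, ← mul_assoc, ← mul_assoc, ← sq, hs]; simp [hz, u]
  have hs0 : (-1 : ℝ) ^ n ≠ 0 := pow_ne_zero _ (by norm_num)
  have huv : u ≠ v := fun e => by
    rw [← e, sub_self] at hvu
    exact mul_ne_zero hs0 hgn.ne' hvu.symm
  have huz : u ≠ z := fun e => by
    rw [← e, sub_self] at hzu
    exact mul_ne_zero hs0 hgn2.ne' hzu.symm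
  have hzv : z ≠ v := fun e => by
    rw [e, hvu] at hzu
    exact hlt.ne' (mul_left_cancel₀ hs0 hzu)
  have hum : u ∈ Set.uIcc x (ret F p q n x) := Set.left_mem_uIcc
  have hvm : v ∈ Set.uIcc x (ret F p q n x) := Set.right_mem_uIcc
  have hzm : z ∈ Set.uIcc x (ret F p q n x) := h.ret_add_two_mem n x
  have b0 := h.abs_log_slope_le_of_mem hK0 hK (le_refl m) hω huv hum hvm
  have b1 := h.abs_log_slope_le_of_mem hK0 hK (le_refl m) hω huz hum hzm
  have b2 := h.abs_log_slope_le_of_mem hK0 hK (le_refl m) hω hzv hzm hvm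
  have p0 := h.slope_iterate_pos m huv
  have p1 := h.slope_iterate_pos m huz
  have p2 := h.slope_iterate_pos m hzv
  set t := gap F p q (n + 2) x / gap F p q n x with ht
  have ht0 : 0 < t := div_pos hgn2 hgn
  have ht1 : t < 1 := (div_lt_one hgn).2 hlt
  have htz : z - u = t * (v - u) := by rw [hzu, hvu, ht]; field_simp
  have hchord : (F^[m] v - F^[m] u) / (v - u) = t * ((F^[m] z - F^[m] u) / (z - u))
      + (1 - t) * ((F^[m] v - F^[m] z) / (v - z)) := by
    have e1 : v - z = (1 - t) * (v - u) := by linarith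
    have d1 : v - u ≠ 0 := sub_ne_zero.2 huv.symm
    have d2 : 1 - t ≠ 0 := by linarith
    rw [e1, htz]
    field_simp
    ring
  set Su := logDerivIter F F' m u
  set Sv := logDerivIter F F' m v
  set Sz := logDerivIter F F' m z
  set L0 := Real.log ((F^[m] v - F^[m] u) / (v - u)) with hL0
  set L1 := Real.log ((F^[m] z - F^[m] u) / (z - u)) with hL1
  set L2 := Real.log ((F^[m] v - F^[m] z) / (v - z)) with hL2
  rw [← Real.exp_log p0, ← Real.exp_log p1, ← Real.exp_log p2, ← hL0, ← hL1, ← hL2] at hchord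
  have hD0 : distortion F F' p q n x = Real.exp (-(Sv - Su) / 2) := rfl
  have hD1 : distortion F F' p q (n + 1) x = Real.exp (-(Sz - Su) / 2) := by
    rw [h.distortion_eq]
  set e0 := L0 - (Su + Sv) / 2 with he0
  set e1 := L1 - (Su + Sz) / 2 with he1
  set e2 := L2 - (Sz + Sv) / 2 with he2
  have hmain : Real.exp (-(Sz - Su) / 2) = t * (Real.exp (-(Sv - Su) / 2) * Real.exp (e1 - e0))
      + (1 - t) * Real.exp (e2 - e0) := by
    have c0 : Real.exp (-(Sz - Su) / 2) = Real.exp L0 * Real.exp (-(Sz + Sv) / 2 - e0) := by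
      rw [← Real.exp_add]; congr 1; rw [he0]; ring
    have c1 : Real.exp (-(Sv - Su) / 2) * Real.exp (e1 - e0)
        = Real.exp L1 * Real.exp (-(Sz + Sv) / 2 - e0) := by
      rw [← Real.exp_add, ← Real.exp_add]; congr 1; rw [he1]; ring
    have c2 : Real.exp (e2 - e0) = Real.exp L2 * Real.exp (-(Sz + Sv) / 2 - e0) := by
      rw [← Real.exp_add]; congr 1; rw [he2]; ring
    rw [c0, c1, c2, hchord]
    ring
  have hω00 : 0 < ω := (h.modulus.pos _ (h.gap_pos n x)).trans_le (hω x)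
  have hexp : ∀ e : ℝ, |e| ≤ K * ω → |Real.exp (e - e0) - 1|
      ≤ Real.exp (2 * (K * W₀)) * (2 * K) * ω := by
    intro e he
    have h1 : |e - e0| ≤ 2 * K * ω := (abs_sub _ _).trans (by linarith)
    have h2 : 2 * K * ω ≤ 2 * (K * W₀) := by nlinarith
    have h3 := abs_exp_sub_one_le_exp_mul (h1.trans h2)
    have h4 := mul_le_mul_of_nonneg_left h1 (Real.exp_pos (2 * (K * W₀))).le
    linarith
  have x1 := hexp e1 b1
  have x2 := hexp e2 b2
  have hD := (h.distortion_le hB n x).1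
  have hD' := Real.exp_pos (-(Sv - Su) / 2)
  rw [hD0] at hD
  rw [hD0, hD1]
  set D := Real.exp (-(Sv - Su) / 2)
  set R := Real.exp (2 * (K * W₀)) * (2 * K) * ω with hR
  have hR0 : 0 ≤ R := (abs_nonneg _).trans x1
  have e : Real.exp (-(Sz - Su) / 2) - 1 = t * (D - 1) + t * (D * (Real.exp (e1 - e0) - 1))
      + (1 - t) * (Real.exp (e2 - e0) - 1) := by rw [hmain]; ring
  rw [e]
  refine (abs_add_three _ _ _).trans ?_
  rw [abs_mul, abs_mul, abs_mul, abs_mul, abs_of_pos ht0, abs_of_pos hD',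
    abs_of_pos (by linarith : 0 < 1 - t)]
  have y1 : t * (D * |Real.exp (e1 - e0) - 1|) ≤ 1 * (Real.exp B * R) := by
    apply mul_le_mul ht1.le _ (by positivity) zero_le_one
    exact mul_le_mul hD x1 (abs_nonneg _) (Real.exp_pos _).le
  have y2 : (1 - t) * |Real.exp (e2 - e0) - 1| ≤ 1 * R :=
    mul_le_mul (by linarith) x2 (abs_nonneg _) zero_le_one
  have : (Real.exp B + 1) * (Real.exp (2 * (K * W₀)) * (2 * K)) * ω = Real.exp B * R + R := by
    rw [hR]; ring
  rw [this]
  linarith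

lemma abs_exp_logDerivIter_succ_sub_one_le (h : IsRotationLift w F F' F'' k p q ρ) {K B W₀ : ℝ}
    (hK0 : 0 < K) (hK : ∀ u v, u ≠ v → |v - u| ≤ 1 →
      |Real.log ((F v - F u) / (v - u)) - (Real.log (F' u) + Real.log (F' v)) / 2|
        ≤ K * (|v - u| * w |v - u|))
    (hB : ∀ n x, |logDerivIter F F' (q n) x| ≤ B) {n : ℕ} {ω : ℝ}
    (hω : ∀ y, w (gap F p q n y) ≤ ω) (hω' : ∀ y, w (gap F p q (n + 1) y) ≤ ω)
    (hω0 : ω ≤ W₀) (x : ℝ) :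
    |Real.exp (logDerivIter F F' (q (n + 1)) x) - 1|
      ≤ gap F p q (n + 1) x / gap F p q n x * |Real.exp (logDerivIter F F' (q n) x) - 1|
        + (Real.exp B + 1) * (Real.exp B * (Real.exp B *
          (Real.exp (K * W₀) * (K * ω) + |distortion F F' p q n x - 1|))) := by
  have hgn := h.gap_pos n x
  have hgn1 := h.gap_pos (n + 1) x
  have hs : ∀ n, ((-1 : ℝ) ^ n) ^ 2 = 1 := fun n => by rw [← pow_mul, mul_comm, pow_mul]; simp
  have hs0 : ∀ n, (-1 : ℝ) ^ n ≠ 0 := fun n => pow_ne_zero _ (by norm_num)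
  have hne : ∀ n, x ≠ ret F p q n x := fun n e => by
    have := h.gap_pos n x
    rw [gap, ← e] at this
    simp at this
  have b0 := h.abs_log_slope_le_of_mem hK0 hK (le_refl (q (n + 1))) hω (hne n)
    Set.left_mem_uIcc Set.right_mem_uIcc
  have b1 := h.abs_log_slope_le_of_mem hK0 hK (m := q n) (n := n + 1)
    ((h.q_le_succ n).trans (h.q_le_succ (n + 1))) hω' (hne (n + 1))
    Set.left_mem_uIcc Set.right_mem_uIcc
  have p0 := h.slope_iterate_pos (q (n + 1)) (hne n)
  have p1 := h.slope_iterate_pos (q n) (hne (n + 1))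
  have hd0 : distortion F F' p q n x = _ := rfl
  have hd1 := h.distortion_eq n x
  rw [distortion] at hd0
  set a := ret F p q n x - x with ha
  set b := ret F p q (n + 1) x - x with hb
  set r := (F^[q (n + 1)] (ret F p q n x) - F^[q (n + 1)] x) / a with hr
  set s := (F^[q n] (ret F p q (n + 1) x) - F^[q n] x) / b with hs'
  have ha0 : a ≠ 0 := sub_ne_zero.2 (hne n).symm
  have hb0 : b ≠ 0 := sub_ne_zero.2 (hne (n + 1)).symm
  have hrel : b * (s - 1) = a * (r - 1) := by
    rw [mul_sub, mul_sub, hr, hs', mul_div_cancel₀ _ ha0, mul_div_cancel₀ _ hb0, mul_one, mul_one,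
      h.iterate_ret, h.iterate_ret, ha, hb]
    have := h.ret_comm n (n + 1) x
    simp only [ret, h.iterate_sub_nat] at this ⊢
    linarith
  set g := gap F p q (n + 1) x / gap F p q n x with hg
  have hg0 : 0 < g := div_pos hgn1 hgn
  have hgB : g ≤ Real.exp B := by
    rw [hg, div_le_iff₀ hgn]
    exact h.gap_succ_le (fun y => (le_abs_self _).trans (hB (n + 1) y)) x
  have habs : |r - 1| = g * |s - 1| := by
    have e := congrArg abs hrel
    rw [abs_mul, abs_mul, ← h.gap_eq_abs, ← h.gap_eq_abs] at e
    rw [hg, div_mul_eq_mul_div, eq_div_iff hgn.ne', e, mul_comm]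
  have hω00 : 0 < ω := (h.modulus.pos _ (h.gap_pos n x)).trans_le (hω x)
  set D := distortion F F' p q n x with hD
  have hDB := (h.distortion_le hB n x).2
  have hD0 : 0 < D := Real.exp_pos _
  have hDinv : D⁻¹ ≤ Real.exp B := by
    rw [← inv_inv (Real.exp B), ← Real.exp_neg]
    exact inv_anti₀ (Real.exp_pos _) hDB
  have herr : ∀ (m : ℕ) (S' ℓ : ℝ), |logDerivIter F F' m x| ≤ B → 0 < ℓ →
      D = Real.exp (-(S' - logDerivIter F F' m x) / 2) →
      |Real.log ℓ - (logDerivIter F F' m x + S') / 2| ≤ K * ω →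
      |Real.exp (logDerivIter F F' m x) - ℓ| ≤
        Real.exp B * (Real.exp B * (Real.exp (K * W₀) * (K * ω) + |D - 1|)) := by
    intro m S' ℓ hS hℓ hDe hle
    set S := logDerivIter F F' m x
    set e := Real.log ℓ - (S + S') / 2 with he
    have h1 : ℓ = Real.exp S * (D⁻¹ * Real.exp e) := by
      rw [hDe, ← Real.exp_neg, ← Real.exp_add, ← Real.exp_add]
      nth_rewrite 1 [← Real.exp_log hℓ]
      congr 1
      rw [he]; ring
    have h2 : |Real.exp e - 1| ≤ Real.exp (K * W₀) * (K * ω) :=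
      (abs_exp_sub_one_le_exp_mul (hle.trans (by gcongr))).trans (by gcongr)
    have h3 : Real.exp S - ℓ = Real.exp S * (D⁻¹ * (-(Real.exp e - 1) + (D - 1))) := by
      rw [h1]; field_simp; ring
    rw [h3, abs_mul, abs_mul, abs_of_pos (Real.exp_pos S), abs_of_pos (inv_pos.2 hD0)]
    have h4 : Real.exp S ≤ Real.exp B := Real.exp_le_exp.2 ((le_abs_self _).trans hS)
    have h5 : |-(Real.exp e - 1) + (D - 1)| ≤ Real.exp (K * W₀) * (K * ω) + |D - 1| := by
      refine (abs_add_le _ _).trans ?_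
      rw [abs_neg]
      linarith
    gcongr
  have r1 := herr (q (n + 1)) _ r (hB _ x) p0 hd0 b0
  have r2 := herr (q n) _ s (hB _ x) p1 hd1 b1
  set E := Real.exp B * (Real.exp B * (Real.exp (K * W₀) * (K * ω) + |D - 1|)) with hE
  have hE0 : 0 ≤ E := (abs_nonneg _).trans r1
  set P := Real.exp (logDerivIter F F' (q (n + 1)) x)
  set Q := Real.exp (logDerivIter F F' (q n) x)
  have t1 : |P - 1| ≤ |P - r| + |r - 1| := abs_sub_le _ _ _
  have t2 : |s - 1| ≤ |Q - s| + |Q - 1| := by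
    rw [abs_sub_comm Q s]; exact abs_sub_le _ _ _
  have t3 : g * |s - 1| ≤ g * |Q - 1| + Real.exp B * E := by
    have : g * |s - 1| ≤ g * (E + |Q - 1|) := by gcongr; linarith
    nlinarith
  nlinarith

end IsRotationLift

/-- A sequence obeying a contracting recursion driven by `ε` is dominated by `ε`, as soon as
`ε` decays more slowly than the contraction. -/
lemma le_mul_of_contracting_recursion {Y ε : ℕ → ℝ} {κ τ C B : ℝ} {d N : ℕ} (hκ0 : 0 < κ)
    (hκ1 : κ ≤ 1) (hε0 : 0 < ε 0) (hε : ∀ n, κ * ε n ≤ ε (n + 1)) (hB : 0 ≤ B)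
    (hY : ∀ n, Y n ≤ B) (hτ0 : 0 ≤ τ) (hτ : τ < κ ^ d) (hd : 0 < d)
    (hrec : ∀ n, N ≤ n → Y (n + d) ≤ τ * Y n + C * ε (n + d)) (n : ℕ) :
    Y n ≤ max (B / (κ ^ (N + d) * ε 0)) (C / (1 - τ / κ ^ d)) * ε n := by
  have hpow : ∀ m j, κ ^ j * ε m ≤ ε (m + j) := by
    intro m j
    induction j with
    | zero => simp
    | succ j ih =>
      calc κ ^ (j + 1) * ε m = κ * (κ ^ j * ε m) := by ring
        _ ≤ κ * ε (m + j) := by gcongr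
        _ ≤ ε (m + (j + 1)) := hε _
  have hpos : ∀ m, 0 < ε m := fun m => by
    have := hpow 0 m
    rw [zero_add] at this
    exact (by positivity : 0 < κ ^ m * ε 0).trans_le this
  set M := max (B / (κ ^ (N + d) * ε 0)) (C / (1 - τ / κ ^ d)) with hM
  have hM0 : 0 ≤ M := le_max_of_le_left (by positivity)
  induction n using Nat.strong_induction_on with
  | _ n ih =>
    rcases lt_or_ge n (N + d) with hn | hn
    · have h1 : κ ^ (N + d) * ε 0 ≤ ε n := by
        refine le_trans ?_ ((hpow 0 n).trans_eq (by rw [zero_add]))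
        have := pow_le_pow_of_le_one hκ0.le hκ1 hn.le
        gcongr
      calc Y n ≤ B := hY n
        _ = B / (κ ^ (N + d) * ε 0) * (κ ^ (N + d) * ε 0) := by field_simp
        _ ≤ M * ε n := by
          apply mul_le_mul (le_max_left _ _) h1 (by positivity) hM0
    · obtain ⟨m, rfl⟩ : ∃ m, n = m + d := ⟨n - d, by omega⟩
      have h1 := ih m (by omega)
      have h2 := hrec m (by omega)
      have h3 := hpow m d
      have hκd : 0 < κ ^ d := by positivity
      have h4 : 0 < 1 - τ / κ ^ d := by rw [sub_pos, div_lt_one hκd]; exact hτ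
      have h5 : C ≤ M * (1 - τ / κ ^ d) := by
        rw [← div_le_iff₀ h4]; exact le_max_right _ _
      have h6 : τ * Y m ≤ τ / κ ^ d * M * ε (m + d) := by
        calc τ * Y m ≤ τ * (M * ε m) := by gcongr
          _ = τ / κ ^ d * M * (κ ^ d * ε m) := by field_simp
          _ ≤ _ := by gcongr
      have h7 := mul_le_mul_of_nonneg_right h5 (hpos (m + d)).le
      linarith

/-- The geometric convolution of the modulus along the powers of `lam`. -/
noncomputable def powConv (w : ℝ → ℝ) (lam : ℝ) (n : ℕ) : ℝ :=
  ∑ j ∈ range (n + 1), lam ^ (n - j) * w (lam ^ j)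

section powConv

variable {w : ℝ → ℝ} {lam : ℝ}

lemma powConv_succ (w : ℝ → ℝ) (lam : ℝ) (n : ℕ) :
    powConv w lam (n + 1) = lam * powConv w lam n + w (lam ^ (n + 1)) := by
  rw [powConv, sum_range_succ, powConv, mul_sum, Nat.sub_self, pow_zero, one_mul]
  congr 1
  refine sum_congr rfl fun j hj => ?_
  have : n + 1 - j = (n - j) + 1 := by
    have := mem_range.1 hj
    omega
  rw [this]
  ring

lemma powConv_zero (w : ℝ → ℝ) (lam : ℝ) : powConv w lam 0 = w 1 := by simp [powConv]

lemma powConv_pos (hw : IsModulus w) (h0 : 0 < lam) (n : ℕ) : 0 < powConv w lam n :=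
  sum_pos (fun j _ => mul_pos (pow_pos h0 _) (hw.pos _ (pow_pos h0 _))) (by simp)

lemma mul_powConv_le (hw : IsModulus w) (h0 : 0 < lam) (n : ℕ) :
    lam * powConv w lam n ≤ powConv w lam (n + 1) := by
  rw [powConv_succ]
  linarith [hw.pos _ (pow_pos h0 (n + 1))]

lemma le_powConv (hw : IsModulus w) (h0 : 0 < lam) (n : ℕ) :
    w (lam ^ n) ≤ powConv w lam n := by
  cases n with
  | zero => simp [powConv_zero]
  | succ n =>
    rw [powConv_succ]
    have := mul_pos h0 (powConv_pos hw h0 n)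
    linarith

lemma tendsto_powConv (hw : IsModulus w) (h0 : 0 < lam) (h1 : lam < 1) :
    Tendsto (powConv w lam) atTop (𝓝 0) := by
  have hδ : Tendsto (fun n : ℕ => w (lam ^ n)) atTop (𝓝 0) :=
    hw.tendsto.comp (tendsto_nhdsWithin_iff.2
      ⟨tendsto_pow_atTop_nhds_zero_of_lt_one h0.le h1,
        Eventually.of_forall fun n => pow_pos h0 n⟩)
  rw [Metric.tendsto_atTop] at hδ ⊢
  intro e he
  obtain ⟨N, hN⟩ := hδ (e * (1 - lam) / 2) (by have := sub_pos.2 h1; positivity)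
  have hstep : ∀ j, powConv w lam (N + j) ≤ lam ^ j * powConv w lam N + e / 2 := by
    intro j
    induction j with
    | zero => simp; linarith
    | succ j ih =>
      have h2 := hN (N + j + 1) (by omega)
      rw [Real.dist_eq, sub_zero] at h2
      have h3 := (le_abs_self _).trans h2.le
      rw [← add_assoc, powConv_succ]
      have := mul_le_mul_of_nonneg_left ih h0.le
      rw [pow_succ lam j]
      linarith
  have hlim : Tendsto (fun j : ℕ => lam ^ j * powConv w lam N) atTop (𝓝 (0 * powConv w lam N)) :=
    (tendsto_pow_atTop_nhds_zero_of_lt_one h0.le h1).mul_const _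
  rw [zero_mul, Metric.tendsto_atTop] at hlim
  obtain ⟨J, hJ⟩ := hlim (e / 2) (by positivity)
  refine ⟨N + J, fun n hn => ?_⟩
  obtain ⟨j, rfl⟩ : ∃ j, n = N + j := ⟨n - N, by omega⟩
  have h2 := hJ j (by omega)
  rw [Real.dist_eq, sub_zero] at h2 ⊢
  rw [abs_of_pos (powConv_pos hw h0 _)]
  have := le_abs_self (lam ^ j * powConv w lam N)
  linarith [hstep j]

end powConv

namespace IsRotationLift

variable {w F F' F'' : ℝ → ℝ} {k p q : ℕ → ℕ} {ρ : ℝ}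

lemma exists_logDerivIter_le_powConv (h : IsRotationLift w F F' F'' k p q ρ) {lam τ : ℝ}
    (h0 : 0 < lam) (h1 : lam < 1) (hτ0 : 0 ≤ τ) (hτ : τ < lam ^ 2) {N : ℕ}
    (hgap : ∀ n, N ≤ n → ∀ x, gap F p q (n + 2) x ≤ τ * gap F p q n x) :
    ∃ C : ℝ, 0 < C ∧ ∀ n x, |logDerivIter F F' (q n) x| ≤ C * powConv w lam n := by
  obtain ⟨K, hK0, hK⟩ := h.exists_log_slope_bound
  obtain ⟨B, hB0, hB⟩ := h.exists_denjoy_bound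
  set ε := powConv w lam with hεdef
  have hε : ∀ n, lam * ε n ≤ ε (n + 1) := mul_powConv_le h.modulus h0
  have hε0 : ∀ n, 0 < ε n := powConv_pos h.modulus h0
  obtain ⟨A, hA0, hA⟩ : ∃ A : ℝ, 0 < A ∧ ∀ n x, gap F p q n x ≤ A * lam ^ n := by
    refine ⟨max (1 / (lam ^ (N + 2) * lam ^ 0)) (0 / (1 - τ / lam ^ 2)),
      lt_max_of_lt_left (by positivity), fun n x => ?_⟩
    exact le_mul_of_contracting_recursion (Y := fun n => gap F p q n x) (ε := fun n => lam ^ n)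
      h0 h1.le (by simp) (fun n => by rw [pow_succ, mul_comm]) zero_le_one
      (fun n => h.gap_le_one n x) hτ0 hτ two_pos
      (fun n hn => by simpa using hgap n hn x) n
  obtain ⟨K', hK'0, hK'⟩ := h.modulus.exists_mul_le A hA0
  have hW : ∀ n x, w (gap F p q n x) ≤ K' * w (lam ^ n) := fun n x =>
    (h.modulus.mono (h.gap_pos n x) (hA n x)).trans (hK' _ (by positivity))
  have hWanti : ∀ n, K' * w (lam ^ (n + 1)) ≤ K' * w (lam ^ n) := fun n => by
    apply mul_le_mul_of_nonneg_left _ hK'0.le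
    exact h.modulus.mono (by positivity) (pow_le_pow_of_le_one h0.le h1.le (Nat.le_succ n))
  have hW0 : ∀ n, K' * w (lam ^ n) ≤ K' * w 1 := fun n => by
    apply mul_le_mul_of_nonneg_left _ hK'0.le
    exact h.modulus.mono (by positivity) (pow_le_one₀ h0.le h1.le)
  have hWε : ∀ n, K' * w (lam ^ n) ≤ K' * ε n := fun n =>
    mul_le_mul_of_nonneg_left (le_powConv h.modulus h0 n) hK'0.le
  have hE : 0 < Real.exp B := Real.exp_pos B
  have hw1 : 0 < w 1 := h.modulus.pos 1 one_pos
  obtain ⟨C₁, hC₁0, hC₁⟩ : ∃ C : ℝ, 0 < C ∧ ∀ n x,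
      |distortion F F' p q (n + 1) x - 1|
        ≤ gap F p q (n + 2) x / gap F p q n x * |distortion F F' p q n x - 1| + C * ε (n + 1) := by
    refine ⟨(Real.exp B + 1) * (Real.exp (2 * (K * (K' * w 1))) * (2 * K)) * (K' / lam),
      by positivity, fun n x => ?_⟩
    refine (h.abs_distortion_succ_sub_one_le hK0 hK hB (hW n) (hW0 n) x).trans ?_
    have h2 : K' * w (lam ^ n) ≤ K' / lam * ε (n + 1) := by
      rw [div_mul_eq_mul_div, le_div_iff₀ h0]
      have := mul_le_mul_of_nonneg_left (hε n) hK'0.le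
      have := mul_le_mul_of_nonneg_right (hWε n) h0.le
      linarith
    have h3 := mul_le_mul_of_nonneg_left h2 (by positivity :
      0 ≤ (Real.exp B + 1) * (Real.exp (2 * (K * (K' * w 1))) * (2 * K)))
    linarith
  obtain ⟨C₂, hC₂0, hC₂⟩ : ∃ C : ℝ, 0 < C ∧ ∀ n x, |distortion F F' p q n x - 1| ≤ C * ε n := by
    refine ⟨max ((Real.exp B + 1) / (lam ^ (N + 1) * ε 0)) (C₁ / (1 - τ / lam ^ 1)),
      lt_max_of_lt_left (by have := hε0 0; positivity), fun n x => ?_⟩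
    refine le_mul_of_contracting_recursion (Y := fun n => |distortion F F' p q n x - 1|) (ε := ε)
      h0 h1.le (hε0 0) hε (by positivity) (fun n => ?_) hτ0 (by nlinarith) one_pos
      (fun n hn => ?_) n
    · have := h.distortion_le hB n x
      have := Real.exp_pos (-B)
      rw [abs_le]
      constructor <;> linarith
    · refine (hC₁ n x).trans ?_
      have : gap F p q (n + 2) x / gap F p q n x ≤ τ := by
        rw [div_le_iff₀ (h.gap_pos n x)]; exact hgap n hn x
      gcongr
  obtain ⟨C₃, hC₃0, hC₃⟩ : ∃ C : ℝ, 0 < C ∧ ∀ n x,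
      |Real.exp (logDerivIter F F' (q (n + 1)) x) - 1|
        ≤ gap F p q (n + 1) x / gap F p q n x * |Real.exp (logDerivIter F F' (q n) x) - 1|
          + C * ε n := by
    refine ⟨(Real.exp B + 1) * (Real.exp B * (Real.exp B *
      (Real.exp (K * (K' * w 1)) * (K * K') + C₂))), by positivity, fun n x => ?_⟩
    refine (h.abs_exp_logDerivIter_succ_sub_one_le hK0 hK hB (hW n)
      (fun y => (hW (n + 1) y).trans (hWanti n)) (hW0 n) x).trans ?_
    have e : (Real.exp B + 1) * (Real.exp B * (Real.exp B *
      (Real.exp (K * (K' * w 1)) * (K * K') + C₂))) * ε n = (Real.exp B + 1) * (Real.exp B *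
      (Real.exp B * (Real.exp (K * (K' * w 1)) * (K * (K' * ε n)) + C₂ * ε n))) := by ring
    rw [e]
    have := hWε n
    have := hC₂ n x
    gcongr
  obtain ⟨C₄, hC₄0, hC₄⟩ : ∃ C : ℝ, 0 < C ∧ ∀ n x, N ≤ n →
      |Real.exp (logDerivIter F F' (q (n + 2)) x) - 1|
        ≤ τ * |Real.exp (logDerivIter F F' (q n) x) - 1| + C * ε (n + 2) := by
    refine ⟨Real.exp B * C₃ / lam ^ 2 + C₃ / lam, by positivity, fun n x hn => ?_⟩
    have hgn := h.gap_pos n x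
    have hgn1 := h.gap_pos (n + 1) x
    have hgn2 := h.gap_pos (n + 2) x
    have a1 := hC₃ n x
    have a2 := hC₃ (n + 1) x
    have hg1 : gap F p q (n + 2) x / gap F p q (n + 1) x ≤ Real.exp B := by
      rw [div_le_iff₀ hgn1]
      exact h.gap_succ_le (fun y => (le_abs_self _).trans (hB (n + 2) y)) x
    have hg : gap F p q (n + 2) x / gap F p q (n + 1) x * (gap F p q (n + 1) x / gap F p q n x)
        ≤ τ := by
      rw [div_mul_div_cancel₀ hgn1.ne', div_le_iff₀ hgn]
      exact hgap n hn x
    have hg0 : 0 < gap F p q (n + 2) x / gap F p q (n + 1) x := div_pos hgn2 hgn1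
    set g' := gap F p q (n + 2) x / gap F p q (n + 1) x
    set g := gap F p q (n + 1) x / gap F p q n x
    set X := |Real.exp (logDerivIter F F' (q n) x) - 1|
    have hX : 0 ≤ X := abs_nonneg _
    have b1 := mul_le_mul_of_nonneg_left a1 hg0.le
    have b2 := mul_le_mul_of_nonneg_right hg hX
    have b3 : g' * (C₃ * ε n) ≤ Real.exp B * C₃ / lam ^ 2 * ε (n + 2) := by
      have c1 : ε n ≤ ε (n + 2) / lam ^ 2 := by
        rw [le_div_iff₀ (by positivity)]
        have := hε (n + 1)
        have := mul_le_mul_of_nonneg_left (hε n) h0.le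
        linarith
      have := hε0 n
      calc g' * (C₃ * ε n) ≤ Real.exp B * (C₃ * (ε (n + 2) / lam ^ 2)) := by gcongr
        _ = _ := by ring
    have b4 : C₃ * ε (n + 1) ≤ C₃ / lam * ε (n + 2) := by
      rw [div_mul_eq_mul_div, le_div_iff₀ h0]
      have := mul_le_mul_of_nonneg_left (hε (n + 1)) hC₃0.le
      linarith
    linarith
  obtain ⟨C₅, hC₅0, hC₅⟩ : ∃ C : ℝ, 0 < C ∧ ∀ n x,
      |Real.exp (logDerivIter F F' (q n) x) - 1| ≤ C * ε n := by
    refine ⟨max ((Real.exp B * B) / (lam ^ (N + 2) * ε 0)) (C₄ / (1 - τ / lam ^ 2)),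
      lt_max_of_lt_left (by have := hε0 0; positivity), fun n x => ?_⟩
    exact le_mul_of_contracting_recursion
      (Y := fun n => |Real.exp (logDerivIter F F' (q n) x) - 1|) (ε := ε)
      h0 h1.le (hε0 0) hε (by positivity)
      (fun n => (abs_exp_sub_one_le_exp_mul (hB n x)).trans (by have := hB n x; gcongr))
      hτ0 hτ two_pos (fun n hn => hC₄ n x hn) n
  refine ⟨Real.exp B * C₅, by positivity, fun n x => ?_⟩
  refine (abs_le_exp_mul_abs_exp_sub_one (hB n x)).trans ?_
  have := hC₅ n x
  rw [mul_assoc]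
  gcongr

lemma gap_add_two_le_div (h : IsRotationLift w F F' F'' k p q ρ) {n : ℕ} {b : ℝ}
    (hb : ∀ x, |logDerivIter F F' (q (n + 1)) x| ≤ b) (x : ℝ) :
    gap F p q (n + 2) x ≤ 1 / (1 + Real.exp (-b)) * gap F p q n x := by
  have h1 := h.gap_add_two_mul_le (fun y => (le_abs_self _).trans (hb y)) x
  rw [div_mul_eq_mul_div, le_div_iff₀ (by positivity), one_mul]
  exact h1

/-- The derivatives of the closest return maps converge uniformly to one. -/
lemma exists_logDerivIter_lt (h : IsRotationLift w F F' F'' k p q ρ) {e : ℝ} (he : 0 < e) :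
    ∃ N, ∀ n, N ≤ n → ∀ x, |logDerivIter F F' (q n) x| ≤ e := by
  obtain ⟨B, hB0, hB⟩ := h.exists_denjoy_bound
  have hτ1 : 1 / (1 + Real.exp (-B)) < 1 := by
    rw [div_lt_one (by positivity)]
    linarith [Real.exp_pos (-B)]
  have hτ0 : 0 < 1 / (1 + Real.exp (-B)) := by positivity
  obtain ⟨s, hs1, hs2⟩ := exists_between hτ1
  have hs0 := hτ0.trans hs1
  have hl0 : 0 < Real.sqrt s := Real.sqrt_pos.2 hs0
  have hl1 : Real.sqrt s < 1 := by rw [Real.sqrt_lt' one_pos]; simpa using hs2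
  obtain ⟨C, hC0, hC⟩ := h.exists_logDerivIter_le_powConv hl0 hl1 hτ0.le
    (by rw [Real.sq_sqrt hs0.le]; exact hs1) (N := 0)
    (fun n _ x => h.gap_add_two_le_div (hB (n + 1)) x)
  have ht := (tendsto_powConv h.modulus hl0 hl1).const_mul C
  rw [mul_zero] at ht
  obtain ⟨N, hN⟩ := eventually_atTop.1 (ht.eventually_le_const he)
  exact ⟨N, fun n hn x => (hC n x).trans (hN n hn)⟩

/-- Any rate slower than `2 ^ (-n / 2)` is admissible for the closest return maps. -/
lemma exists_logDerivIter_le_powConv_of_half_lt (h : IsRotationLift w F F' F'' k p q ρ) {lam : ℝ}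
    (h0 : 0 < lam) (h1 : lam < 1) (hlam : 1 / 2 < lam ^ 2) :
    ∃ C : ℝ, 0 < C ∧ ∀ n x, |logDerivIter F F' (q n) x| ≤ C * powConv w lam n := by
  obtain ⟨τ, hτ1, hτ2⟩ := exists_between hlam
  have hτ0 : 0 < τ := by linarith
  have hcont : Tendsto (fun b : ℝ => 1 / (1 + Real.exp (-b))) (𝓝[>] 0)
      (𝓝 (1 / (1 + Real.exp (-0)))) := by
    refine Tendsto.mono_left ?_ nhdsWithin_le_nhds
    refine ContinuousAt.tendsto (f := fun b : ℝ => 1 / (1 + Real.exp (-b))) ?_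
    exact continuousAt_const.div (by fun_prop) (by positivity)
  have hhalf : 1 / (1 + Real.exp (-0)) < τ := by
    rw [neg_zero, Real.exp_zero]; norm_num; linarith
  obtain ⟨b, hb, hb0⟩ := ((hcont.eventually_lt_const hhalf).and self_mem_nhdsWithin).exists
  obtain ⟨N, hN⟩ := h.exists_logDerivIter_lt hb0
  refine h.exists_logDerivIter_le_powConv h0 h1 hτ0.le hτ2 (N := N) fun n hn x => ?_
  refine (h.gap_add_two_le_div (hN (n + 1) (by omega)) x).trans ?_
  have := h.gap_pos n x
  gcongr

end IsRotationLift

/-- A continuous solution of the cohomological equation yields a `C¹` conjugacy. -/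
lemma IsC2Lift.exists_conjugacy {w F F' F'' : ℝ → ℝ} (h : IsC2Lift w F F' F'') {ρ : ℝ}
    (hrot : Tendsto (fun n : ℕ => (F^[n] 0 - 0) / (n : ℝ)) atTop (𝓝 ρ)) {u : ℝ → ℝ}
    (hu : Continuous u) (hper : ∀ x, u (x + 1) = u x)
    (hcoh : ∀ x, u (F x) - u x = Real.log (F' x)) :
    ∃ Φ Φ' : ℝ → ℝ, Continuous Φ' ∧ (∀ x, 0 < Φ' x) ∧ (∀ x, HasDerivAt Φ (Φ' x) x) ∧
      (∀ x, Φ (x + 1) = Φ x + 1) ∧ (∀ x, Φ (F x) = Φ x + ρ) := by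
  set g : ℝ → ℝ := fun x => Real.exp (-u x) with hg
  have hgc : Continuous g := Real.continuous_exp.comp hu.neg
  have hgp : ∀ x, 0 < g x := fun x => Real.exp_pos _
  have hgF : ∀ x, g (F x) * F' x = g x := fun x => by
    have : -u (F x) = -u x - Real.log (F' x) := by linarith [hcoh x]
    simp only [hg, this, Real.exp_sub, Real.exp_log (h.deriv_pos x)]
    have := (h.deriv_pos x).ne'
    field_simp
  have hI : 0 < ∫ x in (0 : ℝ)..1, g x :=
    intervalIntegral.intervalIntegral_pos_of_pos (hgc.intervalIntegrable _ _) hgp one_pos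
  set I := ∫ x in (0 : ℝ)..1, g x with hIdef
  set Φ : ℝ → ℝ := fun x => (∫ t in (0 : ℝ)..x, g t) / I with hΦ
  have hd : ∀ x, HasDerivAt Φ (g x / I) x := fun x =>
    (intervalIntegral.integral_hasDerivAt_right (hgc.intervalIntegrable _ _)
      (hgc.stronglyMeasurableAtFilter _ _) hgc.continuousAt).div_const I
  have hΦ0 : Φ 0 = 0 := by simp [hΦ]
  have hΦ1 : Φ 1 = 1 := by simp only [hΦ, ← hIdef]; exact div_self hI.ne'
  have hconst : ∀ {f : ℝ → ℝ}, (∀ x, HasDerivAt f 0 x) → ∀ x y, f x = f y := fun hf =>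
    is_const_of_deriv_eq_zero (fun x => (hf x).differentiableAt) fun x => (hf x).deriv
  have hadd : ∀ x, Φ (x + 1) = Φ x + 1 := by
    intro x
    have := hconst (f := fun x => Φ (x + 1) - Φ x) (fun y => by
      have := ((hd (y + 1)).comp_add_const y 1).sub (hd y)
      have e : g (y + 1) / I - g y / I = 0 := by simp [hg, hper]
      rw [e] at this
      exact this) x 0
    simp only [zero_add, hΦ0, hΦ1] at this
    linarith
  set c := Φ (F 0) - Φ 0 with hc
  have hconj : ∀ x, Φ (F x) = Φ x + c := by
    intro x
    have : Φ (F x) - Φ x = Φ (F 0) - Φ 0 := hconst (f := fun x => Φ (F x) - Φ x) (fun y => by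
      have := ((hd (F y)).comp y (h.hasDerivAt y)).sub (hd y)
      rw [div_mul_eq_mul_div, hgF, sub_self] at this
      exact this) x 0
    linarith
  have hiter : ∀ n : ℕ, Φ (F^[n] 0) = n * c := by
    intro n
    induction n with
    | zero => simp [hΦ0]
    | succ n ih =>
      rw [Function.iterate_succ_apply', hconj, ih]
      push_cast
      ring
  obtain ⟨B, hB0, hB⟩ := exists_abs_le_of_periodic (g := fun x => Φ x - x)
    ((continuous_iff_continuousAt.2 fun x => (hd x).continuousAt).sub continuous_id)
    (fun x => by simp only [hadd]; ring)
  have hlim : Tendsto (fun n : ℕ => (F^[n] 0 - 0) / (n : ℝ)) atTop (𝓝 c) := by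
    rw [← tendsto_sub_nhds_zero_iff]
    refine squeeze_zero_norm' ?_ (tendsto_const_div_atTop_nhds_zero_nat B)
    filter_upwards [eventually_gt_atTop 0] with n hn
    have hn' : (0 : ℝ) < n := by exact_mod_cast hn
    have e : (F^[n] 0 - 0) / (n : ℝ) - c = -(Φ (F^[n] 0) - F^[n] 0) / n := by
      rw [hiter]; field_simp; ring
    rw [e, Real.norm_eq_abs, abs_div, abs_neg, abs_of_pos hn']
    have := hB (F^[n] 0)
    gcongr
  have hcρ : c = ρ := tendsto_nhds_unique hlim hrot
  exact ⟨Φ, fun x => g x / I, hgc.div_const I, fun x => div_pos (hgp x) hI, hd, hadd,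
    fun x => by rw [hconj, hcρ]⟩

/-- The Birkhoff-type sum of the logarithmic derivatives of the iterates. -/
noncomputable def sumLogDerivIter (F F' : ℝ → ℝ) (m : ℕ) (x : ℝ) : ℝ :=
  ∑ i ∈ range m, logDerivIter F F' i x

namespace IsRotationLift

variable {w F F' F'' : ℝ → ℝ} {k p q : ℕ → ℕ} {ρ : ℝ}

lemma sumLogDerivIter_sub (h : IsRotationLift w F F' F'' k p q ρ) (m j : ℕ) (x : ℝ) :
    sumLogDerivIter F F' m (F^[j] x) - sumLogDerivIter F F' m x
      = ∑ i ∈ range m, logDerivIter F F' j (F^[i] x) - m * logDerivIter F F' j x := by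
  rw [sumLogDerivIter, sumLogDerivIter, ← sum_sub_distrib]
  rw [sum_congr rfl fun i _ => h.logDerivIter_ret_sub_comm i j x, sum_sub_distrib]
  simp

lemma abs_sumLogDerivIter_add_le (h : IsRotationLift w F F' F'' k p q ρ) {Q : ℕ} {b : ℝ}
    (hb : ∀ x, |logDerivIter F F' Q x| ≤ b) (m : ℕ) (x : ℝ) :
    |sumLogDerivIter F F' (Q + m) x - sumLogDerivIter F F' Q x - sumLogDerivIter F F' m x|
      ≤ m * b := by
  have e1 : sumLogDerivIter F F' (Q + m) x = sumLogDerivIter F F' Q x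
      + (m * logDerivIter F F' Q x + sumLogDerivIter F F' m (F^[Q] x)) := by
    simp only [sumLogDerivIter, sum_range_add, logDerivIter_add, sum_add_distrib, sum_const,
      card_range, nsmul_eq_mul]
  have e2 := h.sumLogDerivIter_sub m Q x
  have e3 : sumLogDerivIter F F' (Q + m) x - sumLogDerivIter F F' Q x - sumLogDerivIter F F' m x
      = ∑ i ∈ range m, logDerivIter F F' Q (F^[i] x) := by linarith
  rw [e3]
  refine (abs_sum_le_sum_abs _ _).trans ((sum_le_sum fun i _ => hb _).trans ?_)
  simp

lemma abs_sumLogDerivIter_mul_add_le (h : IsRotationLift w F F' F'' k p q ρ) {Q : ℕ} {b : ℝ}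
    (hb : ∀ x, |logDerivIter F F' Q x| ≤ b) (a m : ℕ) (x : ℝ) :
    |sumLogDerivIter F F' (a * Q + m) x - a * sumLogDerivIter F F' Q x
        - sumLogDerivIter F F' m x| ≤ a * ((a * Q + m : ℕ) * b) := by
  have hb0 : 0 ≤ b := (abs_nonneg _).trans (hb x)
  induction a with
  | zero => simp
  | succ a ih =>
    have h1 := h.abs_sumLogDerivIter_add_le hb (a * Q + m) x
    have e : (a + 1) * Q + m = Q + (a * Q + m) := by ring
    rw [e]
    have h2 := abs_add_le
      (sumLogDerivIter F F' (Q + (a * Q + m)) x - sumLogDerivIter F F' Q x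
        - sumLogDerivIter F F' (a * Q + m) x)
      (sumLogDerivIter F F' (a * Q + m) x - a * sumLogDerivIter F F' Q x
        - sumLogDerivIter F F' m x)
    have e2 : sumLogDerivIter F F' (Q + (a * Q + m)) x - sumLogDerivIter F F' Q x
        - sumLogDerivIter F F' (a * Q + m) x
        + (sumLogDerivIter F F' (a * Q + m) x - a * sumLogDerivIter F F' Q x
          - sumLogDerivIter F F' m x)
        = sumLogDerivIter F F' (Q + (a * Q + m)) x - ((a + 1 : ℕ) : ℝ) * sumLogDerivIter F F' Q x
          - sumLogDerivIter F F' m x := by push_cast; ring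
    rw [e2] at h2
    have h3 : ((a * Q + m : ℕ) : ℝ) * b ≤ ((Q + (a * Q + m) : ℕ) : ℝ) * b := by
      apply mul_le_mul_of_nonneg_right _ hb0
      exact_mod_cast Nat.le_add_left _ _
    have h4 := mul_le_mul_of_nonneg_left h3 (Nat.cast_nonneg (α := ℝ) a)
    push_cast at h1 h2 h3 h4 ih ⊢
    linarith

lemma continuous_sumLogDerivIter (h : IsRotationLift w F F' F'' k p q ρ) (m : ℕ) :
    Continuous (sumLogDerivIter F F' m) :=
  continuous_finsetSum _ fun i _ => h.continuous_logDerivIter i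

lemma logDerivIter_add_one (h : IsRotationLift w F F' F'' k p q ρ) (m : ℕ) (x : ℝ) :
    logDerivIter F F' m (x + 1) = logDerivIter F F' m x := by
  have := h.logDerivIter_sub_nat m 1 (x + 1)
  rw [Nat.cast_one, add_sub_cancel_right] at this
  exact this.symm

/-- Minus the mean logarithmic derivative of the iterates up to a closest return time. -/
noncomputable def approxTransfer (F F' : ℝ → ℝ) (q : ℕ → ℕ) (n : ℕ) (x : ℝ) : ℝ :=
  -(sumLogDerivIter F F' (q n) x / q n)

lemma abs_approxTransfer_succ_sub_le (h : IsRotationLift w F F' F'' k p q ρ) {n : ℕ} {b : ℝ}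
    (hb : ∀ x, |logDerivIter F F' (q (n + 1)) x| ≤ b) (x : ℝ) :
    |approxTransfer F F' q (n + 2) x - approxTransfer F F' q (n + 1) x|
      ≤ |approxTransfer F F' q (n + 1) x - approxTransfer F F' q n x| / 2 + k (n + 2) * b := by
  have h1 := h.abs_sumLogDerivIter_mul_add_le hb (k (n + 2)) (q n) x
  rw [← h.q_rec n] at h1
  have q0 : (0 : ℝ) < q n := by exact_mod_cast h.q_pos n
  have q1 : (0 : ℝ) < q (n + 1) := by exact_mod_cast h.q_pos (n + 1)
  have q2 : (0 : ℝ) < q (n + 2) := by exact_mod_cast h.q_pos (n + 2)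
  have hq : (q (n + 2) : ℝ) = k (n + 2) * q (n + 1) + q n := by exact_mod_cast h.q_rec n
  have hhalf : (q n : ℝ) / q (n + 2) ≤ 1 / 2 := by
    rw [div_le_div_iff₀ q2 two_pos]
    have a1 : (q n : ℝ) ≤ q (n + 1) := by exact_mod_cast h.q_le_succ n
    have a2 : (q (n + 1) : ℝ) + q n ≤ q (n + 2) := by exact_mod_cast h.add_le_q n
    linarith
  set s0 := sumLogDerivIter F F' (q n) x with hs0
  set s1 := sumLogDerivIter F F' (q (n + 1)) x with hs1
  set s2 := sumLogDerivIter F F' (q (n + 2)) x with hs2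
  have e : approxTransfer F F' q (n + 2) x - approxTransfer F F' q (n + 1) x
      = -(q n / q (n + 2) * (approxTransfer F F' q (n + 1) x - approxTransfer F F' q n x))
        + -((s2 - k (n + 2) * s1 - s0) / q (n + 2)) := by
    simp only [approxTransfer, ← hs0, ← hs1, ← hs2]
    field_simp
    rw [hq]
    ring
  rw [e]
  refine (abs_add_le _ _).trans ?_
  rw [abs_neg, abs_neg, abs_mul, abs_div (s2 - _ - _), abs_of_pos (div_pos q0 q2),
    abs_of_pos q2]
  have t1 : |s2 - k (n + 2) * s1 - s0| / q (n + 2) ≤ k (n + 2) * b := by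
    rw [div_le_iff₀ q2]; linarith
  have t2 := mul_le_mul_of_nonneg_right hhalf
    (abs_nonneg (approxTransfer F F' q (n + 1) x - approxTransfer F F' q n x))
  linarith

lemma approxTransfer_sub (h : IsRotationLift w F F' F'' k p q ρ) (n : ℕ) (x : ℝ) :
    approxTransfer F F' q n (F x) - approxTransfer F F' q n x
      = Real.log (F' x) - logDerivIter F F' (q n) x / q n := by
  have h1 := h.sumLogDerivIter_sub (q n) 1 x
  have q0 : (0 : ℝ) < q n := by exact_mod_cast h.q_pos n
  simp only [logDerivIter_one, Function.iterate_one] at h1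
  have h2 : logDerivIter F F' (q n) x = ∑ i ∈ range (q n), Real.log (F' (F^[i] x)) := rfl
  rw [← h2] at h1
  simp only [approxTransfer]
  field_simp
  linarith

end IsRotationLift

lemma summable_of_half_recursion {D a : ℕ → ℝ} (hD0 : 0 ≤ D 0) (ha0 : ∀ n, 0 ≤ a n)
    (ha : Summable a) (hD : ∀ n, D (n + 1) = D n / 2 + a n) : (∀ n, 0 ≤ D n) ∧ Summable D := by
  have hpos : ∀ n, 0 ≤ D n := fun n => by
    induction n with
    | zero => exact hD0
    | succ n ih => rw [hD]; linarith [ha0 n]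
  refine ⟨hpos, summable_of_sum_range_le (c := 2 * (D 0 + ∑' n, a n)) hpos fun n => ?_⟩
  have h1 : ∑ i ∈ range (n + 1), D i = (∑ i ∈ range n, D i) / 2 + ∑ i ∈ range n, a i + D 0 := by
    rw [sum_range_succ']
    simp only [hD, sum_add_distrib, sum_div]
  rw [sum_range_succ] at h1
  have h2 := ha.sum_le_tsum (range n) fun i _ => ha0 i
  linarith [hpos n]

namespace IsRotationLift

variable {w F F' F'' : ℝ → ℝ} {k p q : ℕ → ℕ} {ρ : ℝ}

lemma exists_transfer (h : IsRotationLift w F F' F'' k p q ρ) {β : ℕ → ℝ}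
    (hβ : ∀ n x, |logDerivIter F F' (q n) x| ≤ β n)
    (hsum : Summable fun n => (k (n + 2) : ℝ) * β (n + 1)) :
    ∃ u : ℝ → ℝ, Continuous u ∧ (∀ x, u (x + 1) = u x) ∧
      ∀ x, u (F x) - u x = Real.log (F' x) := by
  have hβ0 : ∀ n, 0 ≤ β n := fun n => (abs_nonneg _).trans (hβ n 0)
  have hk1 : ∀ n, (1 : ℝ) ≤ k (n + 2) := fun n => by exact_mod_cast h.one_le (n + 1)
  have hβlim : Tendsto β atTop (𝓝 0) := by
    rw [← tendsto_add_atTop_iff_nat 1]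
    refine squeeze_zero (fun n => hβ0 _) (fun n => ?_) hsum.tendsto_atTop_zero
    nlinarith [hβ0 (n + 1), hk1 n]
  set v := approxTransfer F F' q with hv
  have hvc : ∀ n, Continuous (v n) := fun n =>
    ((h.continuous_sumLogDerivIter (q n)).div_const _).neg
  have hvp : ∀ n x, v n (x + 1) = v n x := fun n x => by
    simp only [hv, approxTransfer, sumLogDerivIter, h.logDerivIter_add_one]
  obtain ⟨D₀, hD₀, hD₀'⟩ := exists_abs_le_of_periodic (g := fun x => v 1 x - v 0 x)
    ((hvc 1).sub (hvc 0)) (fun x => by simp only [hvp])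
  let D : ℕ → ℝ := fun n => Nat.rec D₀ (fun n d => d / 2 + k (n + 2) * β (n + 1)) n
  obtain ⟨-, hDs⟩ := summable_of_half_recursion (D := D) (a := fun n => k (n + 2) * β (n + 1))
    hD₀.le (fun n => mul_nonneg (Nat.cast_nonneg _) (hβ0 _)) hsum (fun n => rfl)
  have hDv : ∀ n x, |v (n + 1) x - v n x| ≤ D n := by
    intro n x
    induction n with
    | zero => exact hD₀' x
    | succ n ih =>
      refine (h.abs_approxTransfer_succ_sub_le (hβ (n + 1)) x).trans ?_
      show _ ≤ D n / 2 + k (n + 2) * β (n + 1)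
      linarith
  have hlim : ∀ x, Tendsto (fun n => v n x) atTop (𝓝 (v 0 x + ∑' n, (v (n + 1) x - v n x))) := by
    intro x
    have hs : Summable fun n => v (n + 1) x - v n x :=
      Summable.of_norm_bounded hDs fun n => hDv n x
    have := hs.hasSum.tendsto_sum_nat
    simp only [sum_range_sub (fun n => v n x)] at this
    simpa using this.const_add (v 0 x)
  refine ⟨fun x => v 0 x + ∑' n, (v (n + 1) x - v n x), ?_, fun x => ?_, fun x => ?_⟩
  · exact (hvc 0).add (continuous_tsum (fun n => (hvc (n + 1)).sub (hvc n)) hDs hDv)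
  · simp only [hvp]
  · refine tendsto_nhds_unique ((hlim (F x)).sub (hlim x)) ?_
    simp only [hv, h.approxTransfer_sub]
    have : Tendsto (fun n => logDerivIter F F' (q n) x / q n) atTop (𝓝 0) := by
      refine squeeze_zero_norm (fun n => ?_) hβlim
      rw [Real.norm_eq_abs, abs_div, Nat.abs_cast]
      have q0 : (1 : ℝ) ≤ q n := by exact_mod_cast h.q_pos n
      exact (div_le_self (abs_nonneg _) q0).trans (hβ n x)
    simpa using this.const_sub (Real.log (F' x))

end IsRotationLift

lemma mul_sub_le_setIntegral_sub {f : ℝ → ℝ} (hf : MeasureTheory.IntegrableOn f (Set.Ioc 0 1))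
    {a b C : ℝ} (ha : 0 ≤ a) (hab : a ≤ b) (hb : b ≤ 1) (hC : ∀ x ∈ Set.Ioc a b, C ≤ f x) :
    C * (b - a) ≤ (∫ x in Set.Ioc 0 b, f x) - ∫ x in Set.Ioc 0 a, f x := by
  have hi : MeasureTheory.IntegrableOn f (Set.Ioc a b) :=
    hf.mono_set (Set.Ioc_subset_Ioc ha hb)
  have hi' : MeasureTheory.IntegrableOn f (Set.Ioc 0 a) :=
    hf.mono_set (Set.Ioc_subset_Ioc le_rfl (hab.trans hb))
  have h1 : (∫ x in Set.Ioc 0 b, f x)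
      = (∫ x in Set.Ioc 0 a, f x) + ∫ x in Set.Ioc a b, f x := by
    rw [← Set.Ioc_union_Ioc_eq_Ioc ha hab]
    exact MeasureTheory.setIntegral_union (Set.Ioc_disjoint_Ioc_of_le le_rfl) measurableSet_Ioc
      hi' hi
  have h2 := MeasureTheory.setIntegral_ge_of_const_le_real measurableSet_Ioc
    (by simp) hC hi
  rw [Real.volume_real_Ioc_of_le hab] at h2
  linarith

/-- The integral condition on the modulus and the growth function bounds the corresponding
series along powers of `lam`. -/
lemma summable_mul_powConv {w φ : ℝ → ℝ} (hw : IsModulus w) (hφmono : MonotoneOn φ (Set.Ici 0))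
    (hφpos : ∀ x : ℝ, 0 ≤ x → 0 < φ x) {lam : ℝ} (h0 : 0 < lam) (h1 : lam < 1)
    (hinner : MeasureTheory.IntegrableOn
      (fun x : ℝ => φ (Real.log x / Real.log lam)) (Set.Ioc 0 1))
    (hint : MeasureTheory.IntegrableOn
      (fun y : ℝ =>
        (∫ x in Set.Ioc (0:ℝ) y, φ (Real.log x / Real.log lam)) * w y / y ^ 2)
      (Set.Ioc 0 1)) :
    Summable fun n : ℕ => φ n * powConv w lam n := by
  have hlog : Real.log lam < 0 := Real.log_neg h0 h1
  have h1' : 0 < 1 - lam := sub_pos.2 h1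
  have hp0 : ∀ n : ℕ, 0 < lam ^ n := fun n => pow_pos h0 n
  have hp1 : ∀ n : ℕ, lam ^ n ≤ 1 := fun n => pow_le_one₀ h0.le h1.le
  have hps : ∀ n : ℕ, lam ^ (n + 1) ≤ lam ^ n := fun n =>
    pow_le_pow_of_le_one h0.le h1.le (Nat.le_succ n)
  set ψ : ℝ → ℝ := fun x => φ (Real.log x / Real.log lam) with hψ
  set I : ℝ → ℝ := fun y => ∫ x in Set.Ioc (0 : ℝ) y, ψ x with hI
  set G : ℝ → ℝ := fun y => I y * w y / y ^ 2 with hG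
  set J : ℝ → ℝ := fun y => ∫ x in Set.Ioc (0 : ℝ) y, G x with hJ
  have hψ0 : ∀ x ∈ Set.Ioc (0 : ℝ) 1, 0 ≤ ψ x := fun x hx =>
    (hφpos _ (div_nonneg_of_nonpos (Real.log_nonpos hx.1.le hx.2) hlog.le)).le
  have hImono : ∀ {a b : ℝ}, 0 ≤ a → a ≤ b → b ≤ 1 → I a ≤ I b := fun ha hab hb => by
    have := mul_sub_le_setIntegral_sub hinner ha hab hb (C := 0)
      (fun x hx => hψ0 x ⟨ha.trans_lt hx.1, hx.2.trans hb⟩)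
    rw [zero_mul, sub_nonneg] at this
    exact this
  have hI0 : ∀ {b : ℝ}, 0 ≤ b → b ≤ 1 → 0 ≤ I b := fun hb hb1 => by
    have := hImono le_rfl hb hb1
    simpa [hI] using this
  have hIstep : ∀ n : ℕ, φ n * (lam ^ n * (1 - lam)) ≤ I (lam ^ n) - I (lam ^ (n + 1)) := by
    intro n
    have := mul_sub_le_setIntegral_sub hinner (hp0 (n + 1)).le (hps n) (hp1 n) (C := φ n)
      (fun x hx => by
        have hx0 : 0 < x := (hp0 _).trans hx.1
        have h2 : Real.log x ≤ n * Real.log lam := by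
          rw [← Real.log_pow]
          exact Real.log_le_log hx0 hx.2
        have h3 : (n : ℝ) ≤ Real.log x / Real.log lam := by
          rw [le_div_iff_of_neg hlog]; exact h2
        exact hφmono (Set.mem_Ici.2 (Nat.cast_nonneg n))
          (Set.mem_Ici.2 ((Nat.cast_nonneg n).trans h3)) h3)
    refine le_trans (le_of_eq ?_) this
    rw [pow_succ]
    ring
  have hIsum : ∀ j d : ℕ, (1 - lam) * ∑ n ∈ Ico j (j + d), φ n * lam ^ n
      ≤ I (lam ^ j) - I (lam ^ (j + d)) := by
    intro j d
    induction d with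
    | zero => simp
    | succ d ih =>
      rw [← add_assoc, sum_Ico_succ_top (Nat.le_add_right j d), mul_add]
      linarith [hIstep (j + d)]
  have hJstep : ∀ j : ℕ, I (lam ^ (j + 1)) * w (lam ^ (j + 1)) / lam ^ (j + 1)
      * (lam * (1 - lam)) ≤ J (lam ^ j) - J (lam ^ (j + 1)) := by
    intro j
    have hwp := hw.pos _ (hp0 (j + 1))
    have hIp := hI0 (hp0 (j + 1)).le (hp1 (j + 1))
    have := mul_sub_le_setIntegral_sub hint (hp0 (j + 1)).le (hps j) (hp1 j)
      (C := I (lam ^ (j + 1)) * w (lam ^ (j + 1)) / (lam ^ j) ^ 2)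
      (fun y hy => by
        have hy0 : 0 < y := (hp0 _).trans hy.1
        have t1 := hImono (hp0 (j + 1)).le hy.1.le (hy.2.trans (hp1 j))
        have t2 := hw.mono (hp0 (j + 1)) hy.1.le
        have t3 := hy.2
        have t4 := hIp.trans t1
        have t5 := hwp.le.trans t2
        show I (lam ^ (j + 1)) * w (lam ^ (j + 1)) / (lam ^ j) ^ 2 ≤ I y * w y / y ^ 2
        have t6 := mul_nonneg t4 t5
        gcongr)
    refine le_trans (le_of_eq ?_) this
    have := (hp0 j).ne'
    rw [pow_succ]
    field_simp
  have hJ0 : ∀ n : ℕ, 0 ≤ J (lam ^ n) := fun n =>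
    MeasureTheory.setIntegral_nonneg measurableSet_Ioc fun y hy => by
      have h2 := hI0 hy.1.le (hy.2.trans (hp1 n))
      have h3 := hw.pos y hy.1
      positivity
  have hJsum : ∀ N : ℕ, (lam * (1 - lam)) *
      ∑ j ∈ range N, I (lam ^ (j + 1)) * w (lam ^ (j + 1)) / lam ^ (j + 1)
        ≤ J 1 - J (lam ^ N) := by
    intro N
    induction N with
    | zero => simp
    | succ N ih =>
      rw [sum_range_succ, mul_add]
      linarith [hJstep N]
  refine summable_of_sum_range_le
    (c := (I 1 * w 1 + J 1 / (lam * (1 - lam))) / (1 - lam))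
    (fun n => mul_nonneg (hφpos _ (Nat.cast_nonneg n)).le (powConv_pos hw h0 n).le) fun N => ?_
  have hswap : ∑ n ∈ range N, φ n * powConv w lam n
      = ∑ j ∈ range N, w (lam ^ j) / lam ^ j * ∑ n ∈ Ico j N, φ n * lam ^ n := by
    simp only [powConv, mul_sum]
    rw [sum_comm' (t' := range N) (s' := fun j => Ico j N)
      (fun n j => by simp only [mem_range, mem_Ico]; omega)]
    refine sum_congr rfl fun j _ => sum_congr rfl fun n hn => ?_
    have e : lam ^ n = lam ^ (n - j) * lam ^ j := by
      rw [← pow_add, Nat.sub_add_cancel (mem_Ico.1 hn).1]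
    rw [e]
    have := (hp0 j).ne'
    field_simp
  rw [hswap, le_div_iff₀ h1', mul_comm, mul_sum]
  have hterm : ∀ j ∈ range N, (1 - lam) * (w (lam ^ j) / lam ^ j * ∑ n ∈ Ico j N, φ n * lam ^ n)
      ≤ I (lam ^ j) * w (lam ^ j) / lam ^ j := by
    intro j hj
    obtain ⟨d, rfl⟩ : ∃ d, N = j + d := ⟨N - j, by have := mem_range.1 hj; omega⟩
    have h2 := hIsum j d
    have h3 := hI0 (hp0 (j + d)).le (hp1 (j + d))
    have h4 : 0 ≤ w (lam ^ j) / lam ^ j := (div_pos (hw.pos _ (hp0 j)) (hp0 j)).le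
    calc _ = w (lam ^ j) / lam ^ j * ((1 - lam) * ∑ n ∈ Ico j (j + d), φ n * lam ^ n) := by ring
      _ ≤ w (lam ^ j) / lam ^ j * I (lam ^ j) := by
        apply mul_le_mul_of_nonneg_left _ h4
        linarith
      _ = _ := by ring
  refine (sum_le_sum hterm).trans ?_
  have hT0 : ∀ j : ℕ, 0 ≤ I (lam ^ j) * w (lam ^ j) / lam ^ j := fun j =>
    div_nonneg (mul_nonneg (hI0 (hp0 j).le (hp1 j)) (hw.pos _ (hp0 j)).le) (hp0 j).le
  refine (sum_le_sum_of_subset_of_nonneg (range_mono (Nat.le_succ N))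
    fun j _ _ => hT0 j).trans ?_
  rw [sum_range_succ']
  have h2 : ∑ j ∈ range N, I (lam ^ (j + 1)) * w (lam ^ (j + 1)) / lam ^ (j + 1)
      ≤ J 1 / (lam * (1 - lam)) := by
    rw [le_div_iff₀ (by positivity), mul_comm]
    linarith [hJsum N, hJ0 N]
  simp only [pow_zero, div_one]
  linarith

lemma IsC2Lift.deriv_eq_one_of_deriv_two_eq_zero {w F F' F'' : ℝ → ℝ}
    (h : IsC2Lift w F F' F'') (h2 : ∀ x, F'' x = 0) (x : ℝ) : F' x = 1 := by
  obtain ⟨c, -, hc⟩ := exists_hasDerivAt_eq_slope F F' zero_lt_one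
    h.continuous.continuousOn (fun z _ => h.hasDerivAt z)
  have h3 := h.map_add_one 0
  rw [zero_add] at h3
  rw [h3] at hc
  have h4 : F' x = F' c := is_const_of_deriv_eq_zero
    (fun y => (h.hasDerivAt' y).differentiableAt)
    (fun y => by rw [(h.hasDerivAt' y).deriv, h2]) x c
  rw [h4, hc]
  ring

lemma IsC2Lift.integral_pos_or_deriv_eq_one {w F F' F'' : ℝ → ℝ} (h : IsC2Lift w F F' F'') :
    0 < (∫ x in (0 : ℝ)..1, |F'' x / F' x|) ∨ ∀ x, F' x = 1 := by
  by_cases hex : ∃ c ∈ Set.Icc (0 : ℝ) 1, 0 < |F'' c / F' c|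
  · left
    refine intervalIntegral.integral_pos one_pos ?_ (fun x _ => abs_nonneg _) hex
    exact (h.continuous_deriv_two.div h.continuous_deriv
      fun x => (h.deriv_pos x).ne').abs.continuousOn
  · right
    push Not at hex
    refine h.deriv_eq_one_of_deriv_two_eq_zero fun x => ?_
    have hper : Function.Periodic F'' 1 := h.periodic_deriv_two
    obtain ⟨y, hy, hxy⟩ := hper.exists_mem_Ico₀ one_pos x
    have h1 := abs_nonpos_iff.1 (hex y ⟨hy.1, hy.2.le⟩)
    rw [hxy]
    exact (div_eq_zero_iff.1 h1).resolve_right (h.deriv_pos y).ne'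

lemma one_div_sqrt_one_add_exp_bounds {V lam : ℝ} (hV : 0 < V)
    (hlam : lam = 1 / Real.sqrt (1 + Real.exp (-V))) :
    0 < lam ∧ lam < 1 ∧ 1 / 2 < lam ^ 2 := by
  have he := Real.exp_pos (-V)
  have he1 : Real.exp (-V) < 1 := by rw [Real.exp_lt_one_iff]; linarith
  have hs : 1 < Real.sqrt (1 + Real.exp (-V)) := by
    rw [Real.lt_sqrt zero_le_one]; linarith
  subst hlam
  refine ⟨by positivity, (div_lt_one (by linarith)).2 hs, ?_⟩
  rw [div_pow, Real.sq_sqrt (by positivity), one_pow]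
  exact one_div_lt_one_div_of_lt (by linarith) (by linarith)

end

/-- Main Theorem: if `T` is a `C_{2,ϖ}` circle diffeomorphism whose rotation
number has partial quotients `k_{n+1} = O(φ(n))`, and
`∫₀¹ (∫₀^y φ(log_λ x) dx) ϖ(y)/y² dy < ∞`, then `T` admits a `C¹` conjugacy to
the rigid rotation `R_ρ`. -/
theorem main_theorem_C1_conjugacy
    (w : ℝ → ℝ) (hw : IsModulus w)
    (φ : ℝ → ℝ) (hφmono : MonotoneOn φ (Set.Ici 0))
    (hφcont : ContinuousOn φ (Set.Ici 0)) (hφpos : ∀ x : ℝ, 0 ≤ x → 0 < φ x)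
    (F F' F'' : ℝ → ℝ) (hF : StrictMono F) (hFp : ∀ x, F (x + 1) = F x + 1)
    (hF' : ∀ x, HasDerivAt F (F' x) x) (hF'' : ∀ x, HasDerivAt F' (F'' x) x)
    (hF'pos : ∀ x, 0 < F' x)
    (hmod : ∀ x y : ℝ, x ≠ y → |F'' x - F'' y| ≤ w |x - y|)
    (ρ : ℝ) (hρ : ρ ∈ Set.Ioo (0:ℝ) 1) (hirr : Irrational ρ)
    (hrot : ∀ x : ℝ,
      Filter.Tendsto (fun n : ℕ => (F^[n] x - x) / (n : ℝ)) Filter.atTop (nhds ρ))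
    (k p q : ℕ → ℕ) (hk : ∀ n, 1 ≤ k (n + 1))
    (hp0 : p 0 = 0) (hp1 : p 1 = 1) (hq0 : q 0 = 1) (hq1 : q 1 = k 1)
    (hprec : ∀ n, p (n + 2) = k (n + 2) * p (n + 1) + p n)
    (hqrec : ∀ n, q (n + 2) = k (n + 2) * q (n + 1) + q n)
    (hconv : Filter.Tendsto (fun n => (p n : ℝ) / (q n : ℝ)) Filter.atTop (nhds ρ))
    (c : ℝ) (hc : 0 < c) (hkφ : ∀ n : ℕ, (k (n + 1) : ℝ) ≤ c * φ n)
    (lam : ℝ)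
    (hlam : lam = 1 / Real.sqrt (1 + Real.exp (-(∫ x in (0:ℝ)..1, |F'' x / F' x|))))
    (hinner : MeasureTheory.IntegrableOn
      (fun x : ℝ => φ (Real.log x / Real.log lam)) (Set.Ioc 0 1))
    (hint : MeasureTheory.IntegrableOn
      (fun y : ℝ =>
        (∫ x in Set.Ioc (0:ℝ) y, φ (Real.log x / Real.log lam)) * w y / y ^ 2)
      (Set.Ioc 0 1)) :
    ∃ Φ Φ' : ℝ → ℝ, Continuous Φ' ∧ (∀ x, 0 < Φ' x) ∧
      (∀ x, HasDerivAt Φ (Φ' x) x) ∧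
      (∀ x, Φ (x + 1) = Φ x + 1) ∧
      (∀ x, Φ (F x) = Φ x + ρ) := by
  have hlift : IsC2Lift w F F' F'' := ⟨hw, hF, hFp, hF', hF'', hF'pos, hmod⟩
  have hT : IsRotationLift w F F' F'' k p q ρ :=
    { hlift with
      one_le := hk, p_zero := hp0, p_one := hp1, q_zero := hq0, q_one := hq1
      p_rec := hprec, q_rec := hqrec, tendsto := hconv, rotation := hrot }
  suffices hu : ∃ u : ℝ → ℝ, Continuous u ∧ (∀ x, u (x + 1) = u x) ∧
      ∀ x, u (F x) - u x = Real.log (F' x) by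
    obtain ⟨u, huc, hup, hucoh⟩ := hu
    exact hlift.exists_conjugacy (hrot 0) huc hup hucoh
  rcases hlift.integral_pos_or_deriv_eq_one with hV | h1
  · obtain ⟨hl0, hl1, hl2⟩ := one_div_sqrt_one_add_exp_bounds hV hlam
    obtain ⟨C, hC0, hC⟩ := hT.exists_logDerivIter_le_powConv_of_half_lt hl0 hl1 hl2
    refine hT.exists_transfer hC ?_
    have hs := (summable_nat_add_iff 1).2
      (summable_mul_powConv hw hφmono hφpos hl0 hl1 hinner hint)
    refine Summable.of_nonneg_of_le (fun n => ?_) (fun n => ?_) (hs.mul_left (c * C))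
    · have := powConv_pos hw hl0 (n + 1)
      positivity
    · have h2 := hkφ (n + 1)
      have := powConv_pos hw hl0 (n + 1)
      calc (k (n + 2) : ℝ) * (C * powConv w lam (n + 1))
          ≤ c * φ ((n + 1 : ℕ) : ℝ) * (C * powConv w lam (n + 1)) := by gcongr
        _ = _ := by ring
  · exact ⟨fun _ => 0, continuous_const, fun _ => rfl, fun x => by simp [h1]⟩
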